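/- There are only finitely many tuples (x, y, m, q, p) with x, y, m positive integers, p and q odd primes, p > 3, gcd(x, y) = 1, x² + q^(2m) = 2·y^p, and such that y is not a sum of two consecutive squares (i.e., y ≠ t² + (t+1)² for every integer t). -/

import Mathlib

/-- `δ₄ = 1` if `p ≡ 1 (mod 4)` and `δ₄ = -1` if `p ≡ 3 (mod 4)`. -/
def d4 (p : ℕ) : ℤ := if p % 4 = 1 then 1 else -1

/-- `δ₈ = 1` if `p ≡ 1, 3 (mod 8)` and `δ₈ = -1` if `p ≡ 5, 7 (mod 8)`. -/
def d8 (p : ℕ) : ℤ := if p % 8 = 1 ∨ p % 8 = 3 then 1 else -1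

/-- `F_p(u,v) = Re((1+i)(u+iv)^p)`. -/
def Ffun (p : ℕ) (u v : ℤ) : ℤ :=
  ((⟨1, 1⟩ : GaussianInt) * (⟨u, v⟩ : GaussianInt) ^ p).re

/-- `G_p(u,v) = Im((1+i)(u+iv)^p)`. -/
def Gfun (p : ℕ) (u v : ℤ) : ℤ :=
  ((⟨1, 1⟩ : GaussianInt) * (⟨u, v⟩ : GaussianInt) ^ p).im

/-- `H_p(u,v) = G_p(u,v)/(u + δ₄ v)` (exact division whenever `u + δ₄ v ≠ 0`). -/
def Hfun (p : ℕ) (u v : ℤ) : ℤ := Gfun p u v / (u + d4 p * v)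


/-- Data extracted from a solution. -/
def Sol (p y : ℕ) (s t X E : ℤ) : Prop :=
  s ^ 2 + t ^ 2 = 2 * (y : ℤ) ∧ t ≠ 0 ∧ E ≠ 0 ∧
  (⟨s, t⟩ : GaussianInt) ^ p = (2 : GaussianInt) ^ ((p - 1) / 2) * (⟨X, E⟩ : GaussianInt) ∧
  X ^ 2 + E ^ 2 = 2 * (y : ℤ) ^ p ∧ |E| ≤ p * |t|

lemma gauss_pow_form (s t : ℤ) (n : ℕ) : ∃ a b : ℤ,
    ((⟨s, t⟩ : GaussianInt) ^ (n + 1)).re = s ^ (n + 1) + t ^ 2 * a ∧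
    ((⟨s, t⟩ : GaussianInt) ^ (n + 1)).im = t * ((n + 1) * s ^ n + t ^ 2 * b) := by
  induction n with
  | zero => exact ⟨0, 0, by simp, by simp⟩
  | succ n ih =>
    obtain ⟨a, b, h1, h2⟩ := ih
    refine ⟨s * a - ((n + 1) * s ^ n + t ^ 2 * b), s * b + a, ?_, ?_⟩
    · rw [pow_succ, Zsqrtd.re_mul, h1, h2]; ring
    · rw [pow_succ, Zsqrtd.im_mul, h1, h2]; push_cast; ring

lemma gauss_unit_pow_four (u : GaussianIntˣ) : (u : GaussianInt) ^ 4 = 1 := by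
  have h : Zsqrtd.norm (u : GaussianInt) = 1 := by
    rw [Zsqrtd.norm_eq_one_iff' (by norm_num)]; exact u.isUnit
  generalize (u : GaussianInt) = g at h ⊢
  obtain ⟨a, b⟩ := g
  rw [Zsqrtd.norm_def] at h
  dsimp only at h
  have ha : a ^ 2 ≤ 1 := by nlinarith [sq_nonneg b]
  have ha1 : a ≤ 1 := by nlinarith
  have ha2 : -1 ≤ a := by nlinarith
  have hb : b ^ 2 ≤ 1 := by nlinarith [sq_nonneg a]
  have hb1 : b ≤ 1 := by nlinarith
  have hb2 : -1 ≤ b := by nlinarith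
  interval_cases a <;> interval_cases b <;> first | (exfalso; revert h; decide) | decide

lemma gauss_unit_pow_sq (u : GaussianIntˣ) (p : ℕ) (hp : Odd p) :
    ((u : GaussianInt) ^ p) ^ p = u := by
  obtain ⟨r, rfl⟩ := hp
  rw [← pow_mul]
  have : (2 * r + 1) * (2 * r + 1) = 4 * (r * r + r) + 1 := by ring
  rw [this, pow_add, pow_mul, gauss_unit_pow_four]; simp

lemma I_pow_even (r : ℕ) (h : Even r) :
    (⟨0, 1⟩ : GaussianInt) ^ r = 1 ∨ (⟨0, 1⟩ : GaussianInt) ^ r = -1 := by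
  obtain ⟨k, rfl⟩ := h
  have : (⟨0, 1⟩ : GaussianInt) ^ (k + k) = (-1) ^ k := by
    rw [← two_mul, pow_mul]; congr 1
  rw [this]; exact neg_one_pow_eq_or _ k

/-- the Gaussian factorisation step -/
lemma exists_root (x E y : ℤ) (p : ℕ) (hp : Odd p) (hx : Odd x) (hE : Odd E) (hy : Odd y)
    (hc : IsCoprime x y) (h : x ^ 2 + E ^ 2 = 2 * y ^ p) :
    ∃ b : GaussianInt, (⟨x, E⟩ : GaussianInt) = ⟨1, 1⟩ * b ^ p := by
  obtain ⟨A, hA⟩ : ∃ A, x + E = 2 * A := by obtain ⟨A, hA⟩ := hx.add_odd hE; exact ⟨A, by omega⟩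
  obtain ⟨B, hB⟩ : ∃ B, E - x = 2 * B := by obtain ⟨B, hB⟩ := hE.sub_odd hx; exact ⟨B, by omega⟩
  set z : GaussianInt := ⟨A, B⟩ with hz
  have hxz : (⟨x, E⟩ : GaussianInt) = ⟨1, 1⟩ * z := by
    ext <;> simp [hz] <;> omega
  have hAB : A ^ 2 + B ^ 2 = y ^ p := by
    have e1 : x = A - B := by omega
    have e2 : E = A + B := by omega
    rw [e1, e2] at h; nlinarith
  have hmul : z * star z = (y : GaussianInt) ^ p := by
    have : (y : GaussianInt) ^ p = ((y ^ p : ℤ) : GaussianInt) := by push_cast; rfl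
    rw [this, ← hAB]
    ext
    · rw [Zsqrtd.re_intCast]; simp [hz]; ring
    · rw [Zsqrtd.im_intCast]; simp [hz]; ring
  have hcop : IsCoprime z (star z) := by
    have h1 : IsCoprime (2 * x) (y ^ p) := by
      apply IsCoprime.pow_right
      apply IsCoprime.mul_left _ hc
      obtain ⟨k, hk⟩ := hy
      exact ⟨-k, 1, by rw [hk]; ring⟩
    obtain ⟨a, b, hab⟩ := h1
    -- 2x = (1+i) z + (1-i) star z
    have h2 : ((2 * x : ℤ) : GaussianInt) = ⟨1, 1⟩ * z + ⟨1, -1⟩ * star z := by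
      ext <;> simp [hz] <;> omega
    have hab' : (a : GaussianInt) * ((2 * x : ℤ) : GaussianInt) + (b : GaussianInt) * (y : GaussianInt) ^ p = 1 := by
      have := congrArg (fun n : ℤ => (n : GaussianInt)) hab
      push_cast at this ⊢; exact this
    rw [h2, ← hmul] at hab'
    exact ⟨a * ⟨1, 1⟩ + b * star z, a * ⟨1, -1⟩, by rw [← hab']; ring⟩
  obtain ⟨d, u, hd⟩ := exists_associated_pow_of_mul_eq_pow' hcop hmul
  refine ⟨d * (u : GaussianInt) ^ p, ?_⟩
  rw [mul_pow, gauss_unit_pow_sq u p hp, hd, hxz]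

lemma exists_st (x E y : ℤ) (p : ℕ) (hp : Odd p) (hx : Odd x) (hE : Odd E) (hy : Odd y) (hy0 : 0 < y)
    (hc : IsCoprime x y) (h : x ^ 2 + E ^ 2 = 2 * y ^ p) :
    ∃ s t X E' : ℤ, s ^ 2 + t ^ 2 = 2 * y ∧ (X = x ∨ X = -x) ∧ (E' = E ∨ E' = -E) ∧
     (⟨s, t⟩ : GaussianInt) ^ p = (2 : GaussianInt) ^ ((p - 1) / 2) * (⟨X, E'⟩ : GaussianInt) := by
  obtain ⟨b, hb⟩ := exists_root x E y p hp hx hE hy hc h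
  have hp0 : p ≠ 0 := by rintro rfl; simp at hp
  have hnorm : b.norm = y := by
    have h1 : Zsqrtd.norm (⟨x, E⟩ : GaussianInt) = 2 * b.norm ^ p := by
      rw [hb, Zsqrtd.norm_mul]
      have : (Zsqrtd.norm (b ^ p)) = b.norm ^ p := map_pow Zsqrtd.normMonoidHom b p
      rw [this]; rfl
    rw [Zsqrtd.norm_def] at h1
    have h2 : b.norm ^ p = y ^ p := by simp only at h1; nlinarith
    exact (pow_left_inj₀ (Zsqrtd.norm_nonneg (by norm_num) b) hy0.le hp0).mp h2
  obtain ⟨r, hr⟩ := hp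
  have hr2 : (p - 1) / 2 = r := by omega
  rw [hr2]
  set c : GaussianInt := ⟨1, 1⟩ * b with hcdef
  have h11 : (⟨1, 1⟩ : GaussianInt) ^ 2 = 2 * ⟨0, 1⟩ := by decide
  have hcp : c ^ p = 2 ^ r * ⟨0, 1⟩ ^ r * ⟨x, E⟩ := by
    rw [hcdef, mul_pow, hb, hr, pow_succ (⟨1, 1⟩ : GaussianInt), pow_mul, h11, mul_pow]; ring
  have hcn : c.re ^ 2 + c.im ^ 2 = 2 * y := by
    have : c.norm = 2 * y := by rw [hcdef, Zsqrtd.norm_mul, hnorm]; rfl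
    rw [Zsqrtd.norm_def] at this; linarith
  rcases Nat.even_or_odd r with he | ho
  · have hc' : (⟨c.re, c.im⟩ : GaussianInt) = c := rfl
    rcases I_pow_even r he with h1 | h1
    · refine ⟨c.re, c.im, x, E, hcn, Or.inl rfl, Or.inl rfl, ?_⟩
      rw [hc', hcp, h1, mul_one]
    · refine ⟨c.re, c.im, -x, -E, hcn, Or.inr rfl, Or.inr rfl, ?_⟩
      rw [hc', hcp, h1]
      have : (⟨-x, -E⟩ : GaussianInt) = - ⟨x, E⟩ := by ext <;> simp
      rw [this]; ring
  · have hc' : (⟨c.im, c.re⟩ : GaussianInt) = ⟨0, 1⟩ * star c := by ext <;> simp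
    have hstar : star (c ^ p) = 2 ^ r * (-⟨0, 1⟩) ^ r * ⟨x, -E⟩ := by
      rw [hcp, star_mul', star_mul', star_pow, star_pow]
      congr 1
    have hpw : (⟨c.im, c.re⟩ : GaussianInt) ^ p = 2 ^ r * ((⟨0, 1⟩ : GaussianInt) ^ (r + 1)) * ⟨x, -E⟩ := by
      rw [hc', mul_pow, ← star_pow, hstar]
      have h3 : (⟨0, 1⟩ : GaussianInt) ^ p * (-⟨0, 1⟩) ^ r = ⟨0, 1⟩ ^ (r + 1) := by
        have h4 : (⟨0, 1⟩ : GaussianInt) * (-⟨0, 1⟩) = 1 := by decide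
        rw [hr, show 2 * r + 1 = (r + 1) + r by ring, pow_add, mul_assoc, ← mul_pow, h4]; simp
      rw [← h3]; ring
    rcases I_pow_even (r + 1) ho.add_one with h1 | h1
    · refine ⟨c.im, c.re, x, -E, by linarith, Or.inl rfl, Or.inr rfl, ?_⟩
      rw [hpw, h1, mul_one]
    · refine ⟨c.im, c.re, -x, E, by linarith, Or.inr rfl, Or.inl rfl, ?_⟩
      rw [hpw, h1]
      have : (⟨-x, E⟩ : GaussianInt) = - ⟨x, -E⟩ := by ext <;> simp
      rw [this]; ring

lemma two_pow_mul_im (r : ℕ) (w : GaussianInt) : ((2 : GaussianInt) ^ r * w).im = 2 ^ r * w.im := by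
  have : (2 : GaussianInt) ^ r = ((2 ^ r : ℤ) : GaussianInt) := by push_cast; rfl
  rw [this, Zsqrtd.im_mul, Zsqrtd.re_intCast, Zsqrtd.im_intCast]; ring

lemma exists_sol (x y m q p : ℕ) (hx : 0 < x) (hy : 0 < y) (hm : 0 < m) (hq : q.Prime) (hqo : Odd q)
    (hp : p.Prime) (hpo : Odd p) (hc : Nat.gcd x y = 1)
    (h : x ^ 2 + q ^ (2 * m) = 2 * y ^ p) (hs : ∀ s : ℤ, (y : ℤ) ≠ s ^ 2 + (s + 1) ^ 2) :
    ∃ s t X E : ℤ, Sol p y s t X E := by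
  have hE : Odd ((q : ℤ) ^ m) := by exact_mod_cast hqo.pow
  have hZ : (x : ℤ) ^ 2 + ((q : ℤ) ^ m) ^ 2 = 2 * (y : ℤ) ^ p := by
    rw [← pow_mul, mul_comm m 2]; exact_mod_cast h
  have hxo : Odd (x : ℤ) := by
    by_contra hcon
    rw [Int.not_odd_iff_even] at hcon
    have h1 : Even ((x : ℤ) ^ 2) := hcon.pow_of_ne_zero (by norm_num)
    have h2 : Odd ((x : ℤ) ^ 2 + ((q : ℤ) ^ m) ^ 2) := h1.add_odd hE.pow
    rw [hZ] at h2
    exact (Int.not_odd_iff_even.mpr (even_two_mul _)) h2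
  have hyo : Odd (y : ℤ) := by
    by_contra hcon
    rw [Int.not_odd_iff_even] at hcon
    have h1 : Even ((y : ℤ) ^ p) := hcon.pow_of_ne_zero hp.ne_zero
    obtain ⟨k, hk⟩ := h1
    have h3 := Int.sq_mod_four_eq_one_of_odd hxo
    have h4 := Int.sq_mod_four_eq_one_of_odd hE
    omega
  have hcZ : IsCoprime (x : ℤ) (y : ℤ) := Nat.isCoprime_iff_coprime.mpr hc
  obtain ⟨s, t, X, E, hst, hX, hEE, hpow⟩ := exists_st x (q ^ m) y p hpo hxo hE hyo (by exact_mod_cast hy) hcZ hZ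
  have hqm : (q : ℤ) ^ m ≠ 0 := pow_ne_zero _ (by exact_mod_cast hq.ne_zero)
  have hE0 : E ≠ 0 := by rcases hEE with rfl | rfl <;> simpa using hqm
  have hEabs : E.natAbs = q ^ m := by
    rcases hEE with rfl | rfl
    · rw [Int.natAbs_pow]; simp
    · rw [Int.natAbs_neg, Int.natAbs_pow]; simp
  have hXE : X ^ 2 + E ^ 2 = 2 * (y : ℤ) ^ p := by
    rw [← hZ]; rcases hX with rfl | rfl <;> rcases hEE with rfl | rfl <;> ring
  obtain ⟨a, b, -, him⟩ := gauss_pow_form s t (p - 1)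
  have hp1 : p - 1 + 1 = p := Nat.sub_add_cancel hp.one_le
  rw [hp1, hpow, two_pow_mul_im] at him
  have hcast : ((p - 1 : ℕ) : ℤ) + 1 = p := by
    have := hp.one_le; push_cast [this]; ring
  rw [hcast] at him
  simp only at him
  have hto : Odd t := by
    by_contra hcon
    rw [Int.not_odd_iff_even] at hcon
    obtain ⟨k, hk⟩ := hcon
    obtain ⟨l, hl⟩ := hyo
    rcases Int.even_or_odd s with ⟨j, hj⟩ | ho
    · have : (2 : ℤ) * (j ^ 2 + k ^ 2) = 2 * l + 1 := by rw [hj, hk] at hst; nlinarith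
      omega
    · have := ho.pow (n := 2)
      obtain ⟨w, hw⟩ := this
      have : 2 * w + 1 + 2 * (2 * (k * k)) = 2 * (y : ℤ) := by rw [← hw, ← hst, hk]; ring
      omega
  have ht0 : t ≠ 0 := by rintro rfl; simp at hto
  have hdvd : t.natAbs ∣ q ^ m := by
    have h1 : t ∣ 2 ^ ((p - 1) / 2) * E := ⟨_, him⟩
    have h2 : IsCoprime t (2 ^ ((p - 1) / 2)) := by
      apply IsCoprime.pow_right
      obtain ⟨k, hk⟩ := hto
      exact ⟨1, -k, by rw [hk]; ring⟩
    rw [← hEabs]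
    exact Int.natAbs_dvd_natAbs.mpr (h2.dvd_of_dvd_mul_left h1)
  obtain ⟨k, hk, htk⟩ := (Nat.dvd_prime_pow hq).mp hdvd
  have hk0 : k ≠ 0 := by
    rintro rfl
    have ht1 : t ^ 2 = 1 := by rw [← Int.natAbs_sq, htk]; simp
    have hso : Odd s := by
      by_contra hcon
      rw [Int.not_odd_iff_even] at hcon
      obtain ⟨j, hj⟩ := hcon
      have : 2 * (2 * (j * j)) + 1 = 2 * (y : ℤ) := by rw [← hst, ht1, hj]; ring
      omega
    obtain ⟨j, hj⟩ := hso
    apply hs j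
    rw [ht1, hj] at hst
    nlinarith
  have hqt : (q : ℤ) ∣ t := by
    have : q ∣ t.natAbs := by rw [htk]; exact dvd_pow_self _ hk0
    exact Int.natCast_dvd.mpr this
  have hqp : Prime (q : ℤ) := Nat.prime_iff_prime_int.mp hq
  have hqs : ¬ (q : ℤ) ∣ s := by
    intro hqs
    have h1 : (q : ℤ) ∣ 2 * y := by rw [← hst]; exact dvd_add (dvd_pow hqs (by norm_num)) (dvd_pow hqt (by norm_num))
    have h2 : (q : ℤ) ∣ y := by
      rcases hqp.dvd_or_dvd h1 with h | h
      · exfalso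
        have : q ∣ 2 := by exact_mod_cast h
        have := (Nat.prime_dvd_prime_iff_eq hq Nat.prime_two).mp this
        rw [this] at hqo; exact absurd hqo (by decide)
      · exact h
    have h3 : (q : ℤ) ∣ x := by
      apply hqp.dvd_of_dvd_pow (n := 2)
      have : (x : ℤ) ^ 2 = 2 * (y : ℤ) ^ p - ((q : ℤ) ^ m) ^ 2 := by linarith
      rw [this]
      exact dvd_sub (Dvd.dvd.mul_left (dvd_pow h2 hp.ne_zero) _) (dvd_pow (dvd_pow_self _ hm.ne') (by norm_num))
    exact hqp.not_isUnit (hcZ.isUnit_of_dvd' h3 h2)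
  refine ⟨s, t, X, E, hst, ht0, hE0, hpow, hXE, ?_⟩
  have hEa : |E| = (q : ℤ) ^ m := by rw [Int.abs_eq_natAbs, hEabs]; push_cast; rfl
  have hta : |t| = (q : ℤ) ^ k := by rw [Int.abs_eq_natAbs, htk]; push_cast; rfl
  rw [hEa, hta]
  have hq1 : (1 : ℤ) ≤ q := by exact_mod_cast hq.one_le
  have hpz : (1 : ℤ) ≤ p := by exact_mod_cast hp.one_le
  rcases hk.eq_or_lt with rfl | hlt
  · have : (0 : ℤ) ≤ (q : ℤ) ^ k := by positivity
    nlinarith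
  obtain ⟨d, rfl⟩ := Nat.exists_eq_add_of_lt hlt
  -- cancel q^k
  set V := (p : ℤ) * s ^ (p - 1) + t ^ 2 * b with hV
  have hVd : (q : ℤ) ^ (d + 1) ∣ V := by
    have h1 : (q : ℤ) ^ k * (q : ℤ) ^ (d + 1) ∣ t * V := by
      rw [← him]
      apply Dvd.dvd.mul_left
      rw [← pow_add, ← dvd_abs, hEa]; exact dvd_of_eq (by ring_nf)
    have h2 : (q : ℤ) ^ k * (q : ℤ) ^ (d + 1) ∣ (q : ℤ) ^ k * V := by
      rw [← hta]; rw [← hta] at h1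
      rw [← dvd_abs, abs_mul, abs_abs, ← abs_mul, dvd_abs]; exact h1
    exact (mul_dvd_mul_iff_left (pow_ne_zero k (by exact_mod_cast hq.ne_zero))).mp h2
  have hq_s : ¬ (q : ℤ) ∣ s ^ (p - 1) := fun h => hqs (hqp.dvd_of_dvd_pow h)
  have hqpp : q = p := by
    have h1 : (q : ℤ) ∣ V := dvd_trans (dvd_pow_self _ (by omega)) hVd
    have h2 : (q : ℤ) ∣ (p : ℤ) * s ^ (p - 1) := by
      have : (p : ℤ) * s ^ (p - 1) = V - t ^ 2 * b := by rw [hV]; ring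
      rw [this]; exact dvd_sub h1 (Dvd.dvd.mul_right (dvd_pow hqt (by norm_num)) _)
    rcases hqp.dvd_or_dvd h2 with h | h
    · exact (Nat.prime_dvd_prime_iff_eq hq hp).mp (by exact_mod_cast h)
    · exact absurd h hq_s
  have hd : d = 0 := by
    by_contra hd
    have h1 : (q : ℤ) ^ 2 ∣ V := dvd_trans (pow_dvd_pow _ (by omega)) hVd
    have h2 : (q : ℤ) ^ 2 ∣ (q : ℤ) * s ^ (p - 1) := by
      have : (q : ℤ) * s ^ (p - 1) = V - t ^ 2 * b := by rw [hV, hqpp]; ring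
      rw [this]; exact dvd_sub h1 (Dvd.dvd.mul_right (pow_dvd_pow_of_dvd hqt 2) _)
    rw [pow_two] at h2
    exact hq_s ((mul_dvd_mul_iff_left (by exact_mod_cast hq.ne_zero)).mp h2)
  subst hd
  rw [← hqpp]
  exact le_of_eq (by ring)


open Polynomial in
/-- weighted ℓ¹ norm of a polynomial -/
noncomputable def wn (R : ℝ) (q : ℂ[X]) : ℝ := q.sum fun n c => ‖c‖ * R ^ n

section wn
open Polynomial Finset

lemma wn_eq (R : ℝ) (q : ℂ[X]) (n : ℕ) (h : q.natDegree < n) :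
    wn R q = ∑ a ∈ range n, ‖q.coeff a‖ * R ^ a :=
  sum_over_range' q (by simp) n h

lemma wn_nonneg (R : ℝ) (hR : 0 ≤ R) (q : ℂ[X]) : 0 ≤ wn R q :=
  Finset.sum_nonneg fun i _ => by positivity

lemma coeff_le_wn (R : ℝ) (hR : 0 ≤ R) (q : ℂ[X]) (t : ℕ) : ‖q.coeff t‖ * R ^ t ≤ wn R q := by
  rw [wn_eq R q (q.natDegree + 1 + t) (by omega)]
  exact Finset.single_le_sum (f := fun a => ‖q.coeff a‖ * R ^ a) (fun i _ => by positivity) (by simp)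

lemma wn_add_le (R : ℝ) (hR : 0 ≤ R) (q r : ℂ[X]) : wn R (q + r) ≤ wn R q + wn R r := by
  have h1 : (q + r).natDegree < q.natDegree + r.natDegree + 1 := by
    have := natDegree_add_le q r; omega
  rw [wn_eq R (q + r) _ h1, wn_eq R q (q.natDegree + r.natDegree + 1) (by omega),
    wn_eq R r (q.natDegree + r.natDegree + 1) (by omega), ← Finset.sum_add_distrib]
  refine Finset.sum_le_sum fun i _ => ?_
  rw [coeff_add, ← add_mul]
  exact mul_le_mul_of_nonneg_right (norm_add_le _ _) (by positivity)

lemma wn_sum_le {ι : Type*} (R : ℝ) (hR : 0 ≤ R) (s : Finset ι) (f : ι → ℂ[X]) :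
    wn R (∑ i ∈ s, f i) ≤ ∑ i ∈ s, wn R (f i) := by
  classical
  induction s using Finset.induction_on with
  | empty => simp [wn]
  | insert a s ha ih =>
    rw [Finset.sum_insert ha, Finset.sum_insert ha]
    exact (wn_add_le R hR _ _).trans (by linarith)

lemma wn_monomial (R : ℝ) (n : ℕ) (c : ℂ) : wn R (monomial n c) = ‖c‖ * R ^ n := by
  rw [wn, sum_monomial_index]; simp

lemma wn_monomial_mul (R : ℝ) (n : ℕ) (c : ℂ) (q : ℂ[X]) :
    wn R (monomial n c * q) = ‖c‖ * R ^ n * wn R q := by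
  have h : (monomial n c * q).natDegree < q.natDegree + 1 + n := by
    have h1 := natDegree_mul_le (p := monomial n c) (q := q)
    have h2 := natDegree_monomial_le (R := ℂ) c (m := n)
    omega
  rw [wn_eq R _ _ h, wn_eq R q (q.natDegree + 1) (by omega), Finset.mul_sum, add_comm _ n,
    Finset.sum_range_add]
  have h0 : ∑ x ∈ range n, ‖(monomial n c * q).coeff x‖ * R ^ x = 0 := by
    refine Finset.sum_eq_zero fun x hx => ?_
    rw [← C_mul_X_pow_eq_monomial, mul_assoc, coeff_C_mul, coeff_X_pow_mul']
    have : ¬ n ≤ x := by simpa using hx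
    simp [this]
  rw [h0, zero_add]
  refine Finset.sum_congr rfl fun x _ => ?_
  rw [← C_mul_X_pow_eq_monomial, mul_assoc, coeff_C_mul, coeff_X_pow_mul']
  simp [pow_add]; ring

lemma wn_mul_le (R : ℝ) (hR : 0 ≤ R) (q r : ℂ[X]) : wn R (q * r) ≤ wn R q * wn R r := by
  conv_lhs => rw [q.as_sum_range, Finset.sum_mul]
  refine (wn_sum_le R hR _ _).trans ?_
  rw [wn_eq R q (q.natDegree + 1) (by omega), Finset.sum_mul]
  exact Finset.sum_le_sum fun i _ => (wn_monomial_mul R i _ r).le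

lemma wn_desc (R : ℝ) (hR : 0 ≤ R) (a : ℕ) : wn R (descPochhammer ℂ a) ≤ (R + a) ^ a := by
  have key : ∀ b : ℕ, b ≤ a → wn R (descPochhammer ℂ b) ≤ (R + a) ^ b := by
    intro b hb
    induction b with
    | zero =>
      rw [descPochhammer_zero, ← C_1, ← monomial_zero_left, wn_monomial]; simp
    | succ b ih =>
      rw [descPochhammer_succ_right, pow_succ]
      refine (wn_mul_le R hR _ _).trans ?_
      refine mul_le_mul (ih (by omega)) ?_ (wn_nonneg R hR _) (by positivity)
      have : (X - (b : ℂ[X])) = monomial 1 1 + monomial 0 (-(b : ℂ)) := by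
        rw [monomial_one_one_eq_X]; simp [sub_eq_add_neg]
      rw [this]
      refine (wn_add_le R hR _ _).trans ?_
      rw [wn_monomial, wn_monomial]
      have : b ≤ a := by omega
      simpa using this
  exact key a le_rfl

/-- binomial polynomial -/
noncomputable def chP (a : ℕ) : ℂ[X] := C (1 / (a.factorial : ℂ)) * descPochhammer ℂ a

lemma chP_eval (a x : ℕ) : (chP a).eval (x : ℂ) = (x.choose a : ℂ) := by
  rw [chP, eval_mul, eval_C, descPochhammer_eval_eq_descFactorial, Nat.descFactorial_eq_factorial_mul_choose]
  have : (a.factorial : ℂ) ≠ 0 := by exact_mod_cast a.factorial_ne_zero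
  push_cast; field_simp

lemma chP_natDegree (a : ℕ) : (chP a).natDegree = a := by
  rw [chP, natDegree_C_mul, descPochhammer_natDegree]
  have : (a.factorial : ℂ) ≠ 0 := by exact_mod_cast a.factorial_ne_zero
  simpa using this

lemma wn_chP (R : ℝ) (hR : 0 ≤ R) (a : ℕ) : wn R (chP a) ≤ (R + a) ^ a / a.factorial := by
  rw [chP, ← monomial_zero_left, wn_monomial_mul]
  have := wn_desc R hR a
  simp only [norm_div, norm_one, Complex.norm_natCast, pow_zero, mul_one]
  rw [div_mul_eq_mul_div, one_mul]
  gcongr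

/-- truncated exponential polynomial -/
noncomputable def teP (T : ℕ) (c : ℂ) : ℂ[X] := ∑ m ∈ range T, monomial m (c ^ m / (m.factorial : ℂ))

lemma teP_eval (T : ℕ) (c x : ℂ) : (teP T c).eval x = ∑ m ∈ range T, (c * x) ^ m / (m.factorial : ℂ) := by
  rw [teP, eval_finsetSum]
  refine Finset.sum_congr rfl fun m _ => ?_
  rw [eval_monomial, mul_pow]; ring

lemma teP_natDegree (T : ℕ) (c : ℂ) (hT : 0 < T) : (teP T c).natDegree ≤ T - 1 := by
  refine natDegree_sum_le_of_forall_le _ _ fun i hi => (natDegree_monomial_le _).trans ?_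
  simp at hi; omega

lemma wn_teP (R : ℝ) (hR : 0 ≤ R) (T : ℕ) (c : ℂ) : wn R (teP T c) ≤ Real.exp (‖c‖ * R) := by
  refine (wn_sum_le R hR _ _).trans ?_
  have : ∀ i ∈ range T, wn R (monomial i (c ^ i / (i.factorial : ℂ))) = (‖c‖ * R) ^ i / i.factorial := by
    intro i _
    rw [wn_monomial]; simp [mul_pow]; ring
  rw [Finset.sum_congr rfl this]
  exact Real.sum_le_exp_of_nonneg (by positivity) T
end wn

attribute [local instance] Matrix.seminormedAddCommGroup in
lemma siegel_small {ι : Type*} [Fintype ι] (T : ℕ) (hT : 0 < T) (g : Fin T → ι → ℂ) (G K : ℝ)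
    (hK : 1 ≤ K) (hG : 1 ≤ G) (hg : ∀ t j, ‖g t j‖ ≤ G) (hn : 6 * T ≤ Fintype.card ι) :
    ∃ P : ι → ℤ, P ≠ 0 ∧ (∀ j, |(P j : ℝ)| ≤ Real.sqrt (2 * Fintype.card ι * K * G)) ∧
      ∀ t, ‖∑ j, g t j * (P j : ℂ)‖ ≤
        2 * (Fintype.card ι * Real.sqrt (2 * Fintype.card ι * K * G)) / K := by
  classical
  set n := Fintype.card ι with hndef
  let A : Matrix (Fin T ⊕ Fin T) ι ℤ := fun i j =>
    Sum.elim (fun t => ⌊K * (g t j).re⌋) (fun t => ⌊K * (g t j).im⌋) i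
  have hcard : Fintype.card (Fin T ⊕ Fin T) = 2 * T := by simp; ring
  obtain ⟨P, hP0, hAP, hPn⟩ := Int.Matrix.exists_ne_zero_int_vec_norm_le A
    (by rw [hcard]; omega) (by rw [hcard]; omega)
  have hKG : 1 ≤ K * G := by nlinarith
  have hfl : ∀ x : ℝ, |x| ≤ G → |(⌊K * x⌋ : ℝ)| ≤ 2 * (K * G) := by
    intro x hx
    have h1 := Int.floor_le (K * x)
    have h2 := Int.lt_floor_add_one (K * x)
    have h3 : |K * x| ≤ K * G := by rw [abs_mul, abs_of_nonneg (by linarith : (0:ℝ) ≤ K)]; gcongr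
    rw [abs_le] at h3 ⊢
    constructor <;> linarith
  have hA : ‖A‖ ≤ 2 * (K * G) := by
    rw [Matrix.norm_le_iff (by positivity)]
    rintro (t | t) j
    · rw [Int.norm_eq_abs]; exact hfl _ ((Complex.abs_re_le_norm _).trans (hg t j))
    · rw [Int.norm_eq_abs]; exact hfl _ ((Complex.abs_im_le_norm _).trans (hg t j))
  have hn1 : (1 : ℝ) ≤ n := by exact_mod_cast (by omega : 1 ≤ n)
  have hbase : (n : ℝ) * max 1 ‖A‖ ≤ 2 * n * K * G := by
    have : max 1 ‖A‖ ≤ 2 * (K * G) := max_le (by linarith) hA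
    nlinarith
  have hbase1 : (1 : ℝ) ≤ n * max 1 ‖A‖ := by
    have := le_max_left 1 ‖A‖; nlinarith
  have hPH : ‖P‖ ≤ Real.sqrt (2 * n * K * G) := by
    refine hPn.trans ?_
    rw [hcard, Real.sqrt_eq_rpow]
    have hTn : (6 : ℝ) * T ≤ n := by exact_mod_cast hn
    have hT' : (0 : ℝ) < T := by exact_mod_cast hT
    refine (Real.rpow_le_rpow_of_exponent_le hbase1 (?_ : _ ≤ (1 / 2 : ℝ))).trans ?_
    · push_cast
      rw [div_le_div_iff₀ (by linarith) (by norm_num)]; linarith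
    · exact Real.rpow_le_rpow (by linarith) hbase (by norm_num)
  have hPj : ∀ j, |(P j : ℝ)| ≤ Real.sqrt (2 * n * K * G) := fun j => by
    rw [← Int.norm_eq_abs]; exact (norm_le_pi_norm P j).trans hPH
  refine ⟨P, hP0, hPj, fun t => ?_⟩
  set H := Real.sqrt (2 * n * K * G)
  have hlin : ∀ f : ι → ℝ, (∑ j, ⌊K * f j⌋ * P j = 0) → |∑ j, f j * (P j : ℝ)| ≤ (n * H) / K := by
    intro f hf
    have h1 : ∑ j, (⌊K * f j⌋ : ℝ) * (P j : ℝ) = 0 := by exact_mod_cast hf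
    have h2 : K * ∑ j, f j * (P j : ℝ) = ∑ j, (K * f j - ⌊K * f j⌋) * (P j : ℝ) := by
      simp only [sub_mul, Finset.sum_sub_distrib, h1, sub_zero, Finset.mul_sum, mul_assoc]
    have h3 : |K * ∑ j, f j * (P j : ℝ)| ≤ n * H := by
      rw [h2]
      refine (Finset.abs_sum_le_sum_abs _ _).trans ?_
      have : ∀ j ∈ Finset.univ, |(K * f j - ⌊K * f j⌋) * (P j : ℝ)| ≤ H := by
        intro j _
        rw [abs_mul]
        have h4 : |K * f j - ⌊K * f j⌋| ≤ 1 := by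
          rw [abs_le]; constructor <;> linarith [Int.floor_le (K * f j), Int.lt_floor_add_one (K * f j)]
        calc _ ≤ 1 * |(P j : ℝ)| := by gcongr
          _ ≤ H := by rw [one_mul]; exact hPj j
      refine (Finset.sum_le_card_nsmul _ _ _ this).trans ?_
      rw [Finset.card_univ, nsmul_eq_mul]
    rw [abs_mul, abs_of_nonneg (by linarith : (0:ℝ) ≤ K)] at h3
    rw [le_div_iff₀ (by linarith)]; linarith
  have hre := hlin (fun j => (g t j).re) (by
    have := congrFun hAP (Sum.inl t)
    simpa [Matrix.mulVec, dotProduct, A] using this)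
  have him := hlin (fun j => (g t j).im) (by
    have := congrFun hAP (Sum.inr t)
    simpa [Matrix.mulVec, dotProduct, A] using this)
  refine (Complex.norm_le_abs_re_add_abs_im _).trans ?_
  have e1 : (∑ j, g t j * (P j : ℂ)).re = ∑ j, (g t j).re * (P j : ℝ) := by simp
  have e2 : (∑ j, g t j * (P j : ℂ)).im = ∑ j, (g t j).im * (P j : ℝ) := by simp
  rw [e1, e2]
  have : 2 * (n * H) / K = n * H / K + n * H / K := by ring
  linarith


open Polynomial in
lemma exists_aux (A B T' : ℕ) (hA : 0 < A) (hT' : 0 < T') (ω R K G1 ρ : ℝ) (hω : 0 ≤ ω)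
    (hR : 0 < R) (hρ : B * ω * R ≤ ρ) (hρT : 2 * ρ ≤ T' + 1)
    (hG : ∀ a < A, (R + a) ^ a / a.factorial ≤ G1) (hG1 : 1 ≤ G1) (hK : 1 ≤ K)
    (hcard : 6 * (A + T') ≤ A * B) (H : ℝ) (hH : H = Real.sqrt (2 * (A * B : ℕ) * K * (G1 * Real.exp ρ))) :
    ∃ P : Fin A × Fin B → ℤ, P ≠ 0 ∧ (∀ j, |(P j : ℝ)| ≤ H) ∧
      ∀ x : ℕ, (x : ℝ) ≤ R →
        ‖∑ j, (P j : ℂ) * (x.choose j.1 : ℂ) * Complex.exp (Complex.I * ((j.2 : ℕ) * ω * x : ℝ))‖ ≤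
        (A + T') * (2 * ((A * B : ℕ) * H) / K) + (A * B : ℕ) * (H * G1 * (ρ ^ T' / T'.factorial * 2)) := by
  have hρ0 : 0 ≤ ρ := le_trans (by positivity) hρ
  set q : Fin A × Fin B → ℂ[X] := fun j => chP j.1 * teP T' (Complex.I * ((j.2 : ℕ) * ω : ℝ)) with hq
  have hbω : ∀ b : Fin B, ‖Complex.I * (((b : ℕ) * ω : ℝ) : ℂ)‖ = (b : ℕ) * ω := by
    intro b
    rw [norm_mul, Complex.norm_I, one_mul, Complex.norm_real, Real.norm_eq_abs, abs_of_nonneg (by positivity)]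
  have hbB : ∀ b : Fin B, ((b : ℕ) : ℝ) ≤ B := fun b => by exact_mod_cast b.2.le
  have hwn : ∀ j, wn R (q j) ≤ G1 * Real.exp ρ := by
    intro j
    refine (wn_mul_le R hR.le _ _).trans ?_
    refine mul_le_mul ((wn_chP R hR.le _).trans (hG _ j.1.2)) ((wn_teP R hR.le _ _).trans ?_)
      (wn_nonneg R hR.le _) (by linarith)
    apply Real.exp_le_exp.mpr
    rw [hbω]
    refine le_trans ?_ hρ
    have := hbB j.2
    gcongr
  have hdeg : ∀ j, (q j).natDegree < A + T' := by
    intro j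
    have h1 := natDegree_mul_le (p := chP j.1) (q := teP T' (Complex.I * ((j.2 : ℕ) * ω : ℝ)))
    have h2 := chP_natDegree j.1
    have h3 := teP_natDegree T' (Complex.I * ((j.2 : ℕ) * ω : ℝ)) hT'
    have h4 := j.1.2
    simp only [hq]
    omega
  have hci : Fintype.card (Fin A × Fin B) = A * B := by simp
  obtain ⟨P, hP0, hPH, hPs⟩ := siegel_small (A + T') (by omega)
    (fun t j => (q j).coeff t * (R : ℂ) ^ (t : ℕ)) (G1 * Real.exp ρ) K hK
    (by have := Real.one_le_exp hρ0; nlinarith)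
    (by
      intro t j
      rw [norm_mul, norm_pow, Complex.norm_real, Real.norm_eq_abs, abs_of_pos hR]
      exact (coeff_le_wn R hR.le _ _).trans (hwn j)) (by rw [hci]; exact hcard)
  rw [hci, ← hH] at hPH hPs
  have hH0 : 0 ≤ H := by rw [hH]; positivity
  refine ⟨P, hP0, hPH, fun x hx => ?_⟩
  have hxR0 : (0 : ℝ) ≤ x := by positivity
  -- main part
  have hmain : ‖∑ j, (P j : ℂ) * (q j).eval (x : ℂ)‖ ≤ (A + T') * (2 * ((A * B : ℕ) * H) / K) := by
    have e : ∑ j, (P j : ℂ) * (q j).eval (x : ℂ) =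
        ∑ t : Fin (A + T'), ((x : ℂ) / R) ^ (t : ℕ) * ∑ j, (q j).coeff t * (R : ℂ) ^ (t : ℕ) * (P j : ℂ) := by
      simp only [Finset.mul_sum]
      rw [Finset.sum_comm]
      refine Finset.sum_congr rfl fun j _ => ?_
      rw [eval_eq_sum_range' (hdeg j), Finset.mul_sum, ← Fin.sum_univ_eq_sum_range (fun i => (P j : ℂ) * ((q j).coeff i * (x : ℂ) ^ i))]
      refine Finset.sum_congr rfl fun t _ => ?_
      have : (R : ℂ) ≠ 0 := by exact_mod_cast hR.ne'
      rw [div_pow]; field_simp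
    rw [e]
    refine (norm_sum_le _ _).trans ?_
    have hb : ∀ t ∈ (Finset.univ : Finset (Fin (A + T'))),
        ‖((x : ℂ) / R) ^ (t : ℕ) * ∑ j, (q j).coeff t * (R : ℂ) ^ (t : ℕ) * (P j : ℂ)‖ ≤ 2 * ((A * B : ℕ) * H) / K := by
      intro t _
      rw [norm_mul, norm_pow]
      have h1 : ‖(x : ℂ) / R‖ ≤ 1 := by
        rw [norm_div, Complex.norm_natCast, Complex.norm_real, Real.norm_eq_abs, abs_of_pos hR, div_le_one hR]
        exact hx
      calc _ ≤ 1 * (2 * ((A * B : ℕ) * H) / K) := by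
            refine mul_le_mul (pow_le_one₀ (norm_nonneg _) h1) (hPs t) (norm_nonneg _) zero_le_one
        _ = _ := one_mul _
    refine (Finset.sum_le_card_nsmul _ _ _ hb).trans ?_
    rw [Finset.card_univ, Fintype.card_fin, nsmul_eq_mul]; push_cast; exact le_rfl
  have htail : ‖∑ j, (P j : ℂ) * (x.choose j.1 : ℂ) * Complex.exp (Complex.I * ((j.2 : ℕ) * ω * x : ℝ))
      - ∑ j, (P j : ℂ) * (q j).eval (x : ℂ)‖ ≤ (A * B : ℕ) * (H * G1 * (ρ ^ T' / T'.factorial * 2)) := by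
    rw [← Finset.sum_sub_distrib]
    refine (norm_sum_le _ _).trans ?_
    rw [← hci, ← nsmul_eq_mul, ← Finset.card_univ]
    refine Finset.sum_le_card_nsmul _ _ _ fun j _ => ?_
    have e : (P j : ℂ) * (x.choose j.1 : ℂ) * Complex.exp (Complex.I * ((j.2 : ℕ) * ω * x : ℝ)) - (P j : ℂ) * (q j).eval (x : ℂ)
        = (P j : ℂ) * (x.choose j.1 : ℂ) * (Complex.exp (Complex.I * ((j.2 : ℕ) * ω * x : ℝ)) -
          ∑ m ∈ Finset.range T', (Complex.I * ((j.2 : ℕ) * ω * x : ℝ)) ^ m / (m.factorial : ℂ)) := by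
      rw [hq]; simp only [eval_mul, chP_eval, teP_eval]
      have : Complex.I * (((j.2 : ℕ) * ω : ℝ) : ℂ) * (x : ℂ) = Complex.I * ((j.2 : ℕ) * ω * x : ℝ) := by push_cast; ring
      rw [this]; ring
    rw [e, norm_mul, norm_mul]
    have hnrm : ‖Complex.I * (((j.2 : ℕ) * ω * x : ℝ) : ℂ)‖ ≤ ρ := by
      rw [norm_mul, Complex.norm_I, one_mul, Complex.norm_real, Real.norm_eq_abs, abs_of_nonneg (by positivity)]
      refine le_trans ?_ hρ
      have := hbB j.2
      gcongr
    have h1 : ‖(P j : ℂ)‖ ≤ H := by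
      rw [Complex.norm_intCast]; exact hPH j
    have h2 : ‖(x.choose j.1 : ℂ)‖ ≤ G1 := by
      rw [Complex.norm_natCast]
      refine le_trans ?_ (hG _ j.1.2)
      refine (Nat.choose_le_pow_div (j.1 : ℕ) x).trans ?_
      gcongr
      have : (0 : ℝ) ≤ ((j.1 : ℕ) : ℝ) := by positivity
      linarith
    have h3 : ‖Complex.exp (Complex.I * (((j.2 : ℕ) * ω * x : ℝ) : ℂ)) -
          ∑ m ∈ Finset.range T', (Complex.I * (((j.2 : ℕ) * ω * x : ℝ) : ℂ)) ^ m / (m.factorial : ℂ)‖ ≤ ρ ^ T' / T'.factorial * 2 := by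
      refine (Complex.exp_bound' ?_).trans ?_
      · rw [div_le_div_iff₀ (by positivity) (by norm_num)]
        rw [Nat.cast_succ]
        linarith [hnrm, hρT]
      · gcongr
    gcongr
  calc _ = ‖∑ j, (P j : ℂ) * (q j).eval (x : ℂ) + (∑ j, (P j : ℂ) * (x.choose j.1 : ℂ) * Complex.exp (Complex.I * ((j.2 : ℕ) * ω * x : ℝ))
      - ∑ j, (P j : ℂ) * (q j).eval (x : ℂ))‖ := by congr 1; ring
    _ ≤ _ := (norm_add_le _ _).trans (add_le_add hmain htail)


lemma root_near (α : ℂ) (h : ‖α‖ = 1) (p : ℕ) (hp : 0 < p) :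
    ∃ k < p, ∃ Λ : ℝ, α = Complex.exp (Complex.I * (2 * Real.pi * k / p : ℝ)) * Complex.exp (Complex.I * (Λ / p : ℝ)) ∧
      α ^ p = Complex.exp (Complex.I * (Λ : ℝ)) ∧ |Λ| ≤ 2 * ‖α ^ p - 1‖ := by
  have hpC : (p : ℂ) ≠ 0 := by exact_mod_cast hp.ne'
  set Λ := Complex.arg (α ^ p) with hΛ
  have h1 : α ^ p = Complex.exp (Complex.I * (Λ : ℝ)) := by
    have := Complex.norm_mul_exp_arg_mul_I (α ^ p)
    rw [norm_pow, h, one_pow, Complex.ofReal_one, one_mul] at this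
    rw [mul_comm]; exact this.symm
  set β := α * Complex.exp (-(Complex.I * (Λ / p : ℝ))) with hβ
  have hβp : β ^ p = 1 := by
    rw [hβ, mul_pow, h1, ← Complex.exp_nat_mul, ← Complex.exp_add]
    rw [← Complex.exp_zero]; congr 1
    push_cast; field_simp; ring
  haveI : NeZero p := ⟨hp.ne'⟩
  obtain ⟨k, hk, hk2⟩ := (Complex.isPrimitiveRoot_exp p hp.ne').eq_pow_of_pow_eq_one hβp
  refine ⟨k, hk, Λ, ?_, h1, ?_⟩
  · have e : Complex.exp (Complex.I * (2 * Real.pi * k / p : ℝ)) = β := by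
      rw [← hk2, ← Complex.exp_nat_mul]; congr 1; push_cast; field_simp
    rw [e, hβ, mul_assoc, ← Complex.exp_add]; simp
  · rw [h1, Complex.norm_exp_I_mul_ofReal_sub_one]
    have hpi := Complex.abs_arg_le_pi (α ^ p)
    rw [← hΛ] at hpi
    have h2 : |Λ / 2| ≤ Real.pi / 2 := by rw [abs_div, abs_two]; linarith
    have h3 := Real.mul_abs_le_abs_sin h2
    rw [norm_mul, Real.norm_eq_abs, Real.norm_eq_abs, abs_two]
    rw [abs_div, abs_two] at h3
    have hp0 := Real.pi_pos
    have : |Λ| / Real.pi ≤ |Real.sin (Λ / 2)| := by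
      refine le_trans (le_of_eq ?_) h3; field_simp
    rw [div_le_iff₀ hp0] at this
    have h4 := Real.pi_le_four
    nlinarith [abs_nonneg (Real.sin (Λ / 2))]

noncomputable def zc (s t : ℤ) : ℂ := (s : ℂ) + (t : ℂ) * Complex.I

open ComplexConjugate in
noncomputable def al (s t : ℤ) : ℂ := zc s t / conj (zc s t)

lemma zc_eq (s t : ℤ) : zc s t = GaussianInt.toComplex ⟨s, t⟩ := by
  rw [GaussianInt.toComplex_def]; simp [zc]

lemma zc_norm (s t : ℤ) : ‖zc s t‖ ^ 2 = (s : ℝ) ^ 2 + (t : ℝ) ^ 2 := by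
  rw [← Complex.normSq_eq_norm_sq, Complex.normSq_apply]; simp [zc]; ring

open ComplexConjugate in
lemma zc_sub_conj (s t : ℤ) : ‖zc s t - conj (zc s t)‖ = 2 * |(t : ℝ)| := by
  rw [zc]; simp
  have : (t : ℂ) * Complex.I + (t : ℂ) * Complex.I = (2 * t : ℝ) * Complex.I := by push_cast; ring
  rw [this, norm_mul, Complex.norm_I, mul_one, Complex.norm_real, Real.norm_eq_abs, abs_mul, abs_two]

lemma zc_ne (s t : ℤ) (ht : t ≠ 0) : zc s t ≠ 0 := by
  intro h
  have := zc_norm s t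
  rw [h] at this
  have h2 : (t : ℝ) ≠ 0 := by exact_mod_cast ht
  have := sq_nonneg (s : ℝ)
  have : 0 < (t : ℝ) ^ 2 := by positivity
  simp at *
  linarith

open ComplexConjugate in
lemma al_norm (s t : ℤ) (ht : t ≠ 0) : ‖al s t‖ = 1 := by
  rw [al, norm_div, Complex.norm_conj, div_self (norm_ne_zero_iff.mpr (zc_ne s t ht))]

open ComplexConjugate in
lemma al_sub_one (s t : ℤ) (ht : t ≠ 0) : ‖al s t - 1‖ * ‖zc s t‖ = 2 * |(t : ℝ)| := by
  rw [← zc_sub_conj, ← Complex.norm_conj (zc s t), ← norm_mul, sub_mul, al, div_mul_cancel₀ _ ((map_ne_zero _).mpr (zc_ne s t ht)), one_mul]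

lemma sol_pow {p y : ℕ} {s t X E : ℤ} (h : Sol p y s t X E) :
    zc s t ^ p = 2 ^ ((p - 1) / 2) * zc X E := by
  obtain ⟨-, -, -, h4, -⟩ := h
  rw [zc_eq, zc_eq, ← map_pow, h4, map_mul, map_pow]; congr 2; exact map_ofNat _ 2

open ComplexConjugate in
lemma sol_al_pow {p y : ℕ} {s t X E : ℤ} (h : Sol p y s t X E) : al s t ^ p = al X E := by
  have h2 : conj (zc s t) ^ p = 2 ^ ((p - 1) / 2) * conj (zc X E) := by
    rw [← map_pow, sol_pow h, map_mul, map_pow]; congr 2; exact map_ofNat _ 2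
  rw [al, div_pow, sol_pow h, h2, al, mul_div_mul_left]
  exact pow_ne_zero _ two_ne_zero

lemma sol_norm {p y : ℕ} {s t X E : ℤ} (h : Sol p y s t X E) : ‖zc s t‖ ^ 2 = 2 * y := by
  rw [zc_norm]; exact_mod_cast h.1

lemma sol_norm' {p y : ℕ} {s t X E : ℤ} (h : Sol p y s t X E) : ‖zc X E‖ ^ 2 = 2 * (y : ℝ) ^ p := by
  rw [zc_norm]; exact_mod_cast h.2.2.2.2.1

lemma sol_close {p y : ℕ} {s t X E : ℤ} (h : Sol p y s t X E) (hp : Odd p) (hy : 0 < y) :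
    ‖al s t ^ p - 1‖ * (y : ℝ) ^ ((p - 1) / 2) ≤ 2 * p := by
  rw [sol_al_pow h]
  have h1 := al_sub_one X E h.2.2.1
  have h2 := sol_norm' h
  have h3 : (|E| : ℝ) ≤ p * |(t : ℝ)| := by exact_mod_cast h.2.2.2.2.2
  have h4 : (t : ℝ) ^ 2 ≤ 2 * y := by
    have : (s : ℝ) ^ 2 + (t : ℝ) ^ 2 = 2 * y := by exact_mod_cast h.1
    nlinarith [sq_nonneg (s : ℝ)]
  have hy' : (0 : ℝ) < y := by exact_mod_cast hy
  apply abs_le_of_sq_le_sq' _ (by positivity) |>.2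
  have h5 : (‖al X E - 1‖ * (y : ℝ) ^ ((p - 1) / 2)) ^ 2 * (2 * y) = 4 * (E : ℝ) ^ 2 := by
    obtain ⟨r, hr⟩ := hp
    have : (p - 1) / 2 = r := by omega
    rw [this]
    have : (y : ℝ) ^ p = (y ^ r) ^ 2 * y := by rw [hr]; ring
    calc _ = ‖al X E - 1‖ ^ 2 * (2 * y ^ p) := by rw [this]; ring
      _ = (‖al X E - 1‖ * ‖zc X E‖) ^ 2 := by rw [← h2]; ring
      _ = _ := by rw [h1, mul_pow, sq_abs]; ring
  have h6 : (E : ℝ) ^ 2 ≤ p ^ 2 * (2 * y) := by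
    calc (E : ℝ) ^ 2 = |(E : ℝ)| ^ 2 := (sq_abs _).symm
      _ ≤ (p * |(t : ℝ)|) ^ 2 := by gcongr
      _ = p ^ 2 * t ^ 2 := by rw [mul_pow, sq_abs]
      _ ≤ _ := by gcongr
  have : (‖al X E - 1‖ * (y : ℝ) ^ ((p - 1) / 2)) ^ 2 * (2 * y) ≤ (2 * p) ^ 2 * (2 * y) := by
    rw [h5]; linarith
  exact le_of_mul_le_mul_right this (by positivity)


open Polynomial Finset in
lemma coeff_prod_le {ι : Type*} (s : Finset ι) (f : ι → ℂ[X]) (d : ι → ℕ) (h : ∀ i ∈ s, (f i).natDegree ≤ d i) :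
    (∏ i ∈ s, f i).coeff (∑ i ∈ s, d i) = ∏ i ∈ s, (f i).coeff (d i) := by
  classical
  induction s using Finset.induction_on with
  | empty => simp
  | insert a s ha ih =>
    rw [Finset.prod_insert ha, Finset.sum_insert ha, Finset.prod_insert ha,
      coeff_mul_add_eq_of_natDegree_le (h a (by simp)), ih fun i hi => h i (by simp [hi])]
    refine (natDegree_prod_le _ _).trans (Finset.sum_le_sum fun i hi => h i (by simp [hi]))

open Polynomial in
lemma binom_indep (A : ℕ) (c : Fin A → ℤ) (h : ∑ a, C (c a : ℂ) * chP a = 0) : c = 0 := by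
  have h1 : ∀ x : ℕ, ∑ a : Fin A, c a * (x.choose a : ℤ) = 0 := by
    intro x
    have := congrArg (eval (x : ℂ)) h
    simp only [eval_finsetSum, eval_mul, eval_C, chP_eval, eval_zero] at this
    exact_mod_cast this
  have key : ∀ n : ℕ, ∀ hn : n < A, c ⟨n, hn⟩ = 0 := by
    intro n
    induction n using Nat.strong_induction_on with
    | _ n ih =>
      intro hn
      have := h1 n
      rw [Finset.sum_eq_single ⟨n, hn⟩] at this
      · simpa using this
      · intro b _ hb
        rcases lt_trichotomy (b : ℕ) n with h | h | h
        · have := ih b h b.2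
          simp only [Fin.eta] at this
          rw [this, zero_mul]
        · exact absurd (Fin.ext h) hb
        · rw [Nat.choose_eq_zero_of_lt h]; simp
      · simp
  funext a; exact key a a.2

open Polynomial in
lemma zero_est (A B k p N2 M : ℕ) (hA : 0 < A) (α : ℂ) (hα : α ≠ 0) (hdist : ∀ n, 0 < n → n < B → α ^ n ≠ 1)
    (hkp : Nat.Coprime k p) (hp : 0 < p) (hN2 : N2 ≤ p) (hcard : (A - 1) * B < N2 * M)
    (P : Fin A × Fin B → ℤ)
    (hz : ∀ n < N2 + B, ∀ m < M, ∑ j, (P j : ℂ) * ((k * n + p * m).choose j.1 : ℂ) * α ^ ((j.2 : ℕ) * n) = 0) :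
    P = 0 := by
  classical
  by_contra hP
  set Q : Fin B → ℂ[X] := fun b => ∑ a : Fin A, C (P (a, b) : ℂ) * chP a with hQ
  have hQdeg : ∀ b, (Q b).natDegree ≤ A - 1 := by
    intro b
    refine natDegree_sum_le_of_forall_le _ _ fun a _ => ?_
    refine (natDegree_C_mul_le _ _).trans ?_
    rw [chP_natDegree]; have := a.2; omega
  obtain ⟨b0, hb0⟩ : ∃ b0, Q b0 ≠ 0 := by
    by_contra! hcon
    apply hP
    funext ⟨a, b⟩
    exact congrFun (binom_indep A (fun a => P (a, b)) (hcon b)) a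
  set Qt : Fin B → ℂ[X] := fun b => if Q b = 0 then 1 else Q b with hQt
  have hQtdeg : ∀ b, (Qt b).natDegree ≤ A - 1 := by
    intro b; simp only [hQt]; split_ifs
    · simp
    · exact hQdeg b
  have hQt0 : ∀ b, Qt b ≠ 0 := by
    intro b; simp only [hQt]; split_ifs with h
    · exact one_ne_zero
    · exact h
  let W : Matrix (Fin B) (Fin B) ℂ[X] := fun e b => (Qt b).comp (X + C ((k * (e : ℕ) : ℕ) : ℂ)) * C (α ^ ((e : ℕ) * (b : ℕ)))
  have hWd : ∀ e b, (W e b).natDegree ≤ (Qt b).natDegree := by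
    intro e b
    refine (natDegree_mul_C_le _ _).trans ?_
    rw [natDegree_comp, natDegree_X_add_C, mul_one]
  have hWc : ∀ e b, (W e b).coeff (Qt b).natDegree = (Qt b).leadingCoeff * α ^ ((e : ℕ) * (b : ℕ)) := by
    intro e b
    simp only [W]
    rw [coeff_mul_C]
    congr 1
    have h2 : ((Qt b).comp (X + C ((k * (e : ℕ) : ℕ) : ℂ))).natDegree = (Qt b).natDegree := by
      rw [natDegree_comp, natDegree_X_add_C, mul_one]
    have h1 : ((Qt b).comp (X + C ((k * (e : ℕ) : ℕ) : ℂ))).leadingCoeff = (Qt b).leadingCoeff := by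
      rw [leadingCoeff_comp (by rw [natDegree_X_add_C]; norm_num), leadingCoeff_X_add_C, one_pow, mul_one]
    rw [← h1, leadingCoeff, h2]
  have hDdeg : W.det.natDegree ≤ (A - 1) * B := by
    rw [Matrix.det_apply]
    refine natDegree_sum_le_of_forall_le _ _ fun σ _ => ?_
    refine (natDegree_smul_le _ _).trans ?_
    refine (natDegree_prod_le _ _).trans ?_
    refine (Finset.sum_le_card_nsmul _ _ (A - 1) fun i _ => (hWd _ _).trans (hQtdeg i)).trans ?_
    simp [mul_comm]
  have hDz : ∀ i : Fin N2 × Fin M, W.det.eval ((k * (i.1 : ℕ) + p * (i.2 : ℕ) : ℕ) : ℂ) = 0 := by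
    rintro ⟨n, m⟩
    rw [← Polynomial.coe_evalRingHom, RingHom.map_det]
    rw [← Matrix.exists_mulVec_eq_zero_iff]
    refine ⟨fun b => if Q b = 0 then 0 else α ^ ((n : ℕ) * (b : ℕ)), ?_, ?_⟩
    · intro h
      have := congrFun h b0
      simp [hb0, hα] at this
    · funext e
      have h1 := hz (n + e) (by have := n.2; have := e.2; omega) m m.2
      simp only [Pi.zero_apply]
      refine Eq.trans ?_ h1
      rw [Fintype.sum_prod_type_right]
      simp only [Matrix.mulVec, dotProduct]
      refine Finset.sum_congr rfl fun b _ => ?_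
      have h3 : ∑ a : Fin A, (P (a, b) : ℂ) * ((k * (n + e) + p * m : ℕ).choose (a : ℕ) : ℂ) * α ^ ((b : ℕ) * ((n : ℕ) + e))
          = (Q b).eval (((k * (n + e) + p * m : ℕ) : ℂ)) * α ^ ((b : ℕ) * ((n : ℕ) + e)) := by
        simp only [hQ, eval_finsetSum, eval_mul, eval_C, chP_eval, Finset.sum_mul]
      rw [h3]
      rw [RingHom.mapMatrix_apply, Matrix.map_apply, Polynomial.coe_evalRingHom]
      have hWeb : W e b = (Qt b).comp (X + C ((k * (e : ℕ) : ℕ) : ℂ)) * C (α ^ ((e : ℕ) * (b : ℕ))) := rfl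
      rw [hWeb]
      by_cases hb : Q b = 0
      · simp [hb]
      · simp only [hQt, hb, if_false]
        simp only [eval_mul, eval_C, eval_comp, eval_add, eval_X]
        rw [mul_assoc, ← pow_add]
        congr 2
        · push_cast; ring
        · ring
  have hinj : Function.Injective (fun i : Fin N2 × Fin M => ((k * (i.1 : ℕ) + p * (i.2 : ℕ) : ℕ) : ℂ)) := by
    rintro ⟨n, m⟩ ⟨n', m'⟩ h
    have h : k * (n : ℕ) + p * (m : ℕ) = k * (n' : ℕ) + p * (m' : ℕ) := by
      have h' : ((k * (n : ℕ) + p * (m : ℕ) : ℕ) : ℂ) = ((k * (n' : ℕ) + p * (m' : ℕ) : ℕ) : ℂ) := h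
      exact_mod_cast h'
    have h1 : k * (n : ℕ) ≡ k * (n' : ℕ) [MOD p] := by
      have := congrArg (· % p) h
      simpa [Nat.ModEq, Nat.add_mul_mod_self_left] using this
    have h2 : (n : ℕ) ≡ n' [MOD p] := Nat.ModEq.cancel_left_of_coprime (by rw [Nat.gcd_comm]; exact hkp) h1
    have h3 : (n : ℕ) = n' := Nat.ModEq.eq_of_lt_of_lt h2 (by omega) (by omega)
    have h4 : (m : ℕ) = m' := by
      rw [h3] at h
      exact Nat.eq_of_mul_eq_mul_left hp (by omega)
    ext <;> simpa
  have hD0 : W.det = 0 := by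
    refine eq_zero_of_natDegree_lt_card_of_eval_eq_zero W.det hinj hDz ?_
    simp; omega
  have hDc : W.det.coeff (∑ b, (Qt b).natDegree) = (∏ b, (Qt b).leadingCoeff) * (Matrix.vandermonde (fun e : Fin B => α ^ (e : ℕ))).det := by
    rw [Matrix.det_apply, Matrix.det_apply, finsetSum_coeff, Finset.mul_sum]
    refine Finset.sum_congr rfl fun σ _ => ?_
    rw [coeff_smul, coeff_prod_le _ _ _ fun i _ => hWd _ _]
    rw [mul_smul_comm, ← Finset.prod_mul_distrib]
    congr 1
    refine Finset.prod_congr rfl fun b _ => ?_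
    rw [hWc, Matrix.vandermonde_apply, pow_mul]
  rw [hD0, coeff_zero] at hDc
  rcases mul_eq_zero.mp hDc.symm with h | h
  · rw [Finset.prod_eq_zero_iff] at h
    obtain ⟨b, _, hb⟩ := h
    exact hQt0 b (leadingCoeff_eq_zero.mp hb)
  · refine (Matrix.det_vandermonde_ne_zero_iff.mpr ?_) h
    have hlt : ∀ e e' : Fin B, (e : ℕ) < e' → α ^ (e : ℕ) ≠ α ^ (e' : ℕ) := by
      intro e e' hlt heq
      have := e'.2
      refine hdist ((e' : ℕ) - e) (by omega) (by omega) ?_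
      have h5 : α ^ (e' : ℕ) = α ^ (e : ℕ) * α ^ ((e' : ℕ) - e) := by rw [← pow_add]; congr 1; omega
      rw [h5] at heq
      exact (mul_left_cancel₀ (pow_ne_zero _ hα) (by rw [mul_one]; exact heq)).symm
    intro e e' h
    rcases lt_trichotomy (e : ℕ) e' with h' | h' | h'
    · exact absurd h (hlt _ _ h')
    · exact Fin.ext h'
    · exact absurd h.symm (hlt _ _ h')


lemma norm_pow_sub_pow_le_aux (a b : ℂ) (ha : ‖a‖ = 1) (hb : ‖b‖ = 1) (n : ℕ) : ‖a ^ n - b ^ n‖ ≤ n * ‖a - b‖ := by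
  induction n with
  | zero => simp
  | succ n ih =>
    have : a ^ (n + 1) - b ^ (n + 1) = a * (a ^ n - b ^ n) + (a - b) * b ^ n := by ring
    rw [this]
    refine (norm_add_le _ _).trans ?_
    rw [norm_mul, norm_mul, norm_pow, ha, hb]
    push_cast; simp; linarith

lemma gauss_small (g : GaussianInt) (h : ‖GaussianInt.toComplex g‖ < 1) : g = 0 := by
  have h1 : ‖GaussianInt.toComplex g‖ ^ 2 < 1 := by
    have := norm_nonneg (GaussianInt.toComplex g); nlinarith
  rw [← Complex.normSq_eq_norm_sq, ← GaussianInt.intCast_real_norm] at h1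
  have h2 : g.norm < 1 := by exact_mod_cast h1
  have h3 := GaussianInt.norm_nonneg g
  exact Zsqrtd.norm_eq_zero_iff (by norm_num) g |>.mp (by omega)

open ComplexConjugate in
lemma clear_denom (s t : ℤ) (ht : t ≠ 0) (D : ℕ) {ι : Type*} [Fintype ι] (c : ι → ℤ) (e : ι → ℕ) (he : ∀ i, e i ≤ D) :
    ∃ g : GaussianInt, GaussianInt.toComplex g = conj (zc s t) ^ D * ∑ i, (c i : ℂ) * al s t ^ (e i) := by
  refine ⟨∑ i, (c i : GaussianInt) * ((⟨s, t⟩ : GaussianInt) ^ (e i) * (star (⟨s, t⟩ : GaussianInt)) ^ (D - e i)), ?_⟩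
  rw [map_sum, Finset.mul_sum]
  refine Finset.sum_congr rfl fun i _ => ?_
  have hz : conj (zc s t) ≠ 0 := (map_ne_zero _).mpr (zc_ne s t ht)
  rw [map_mul, map_mul, map_pow, map_pow, map_intCast, GaussianInt.toComplex_star, ← zc_eq, al, div_pow]
  have : conj (zc s t) ^ D = conj (zc s t) ^ (e i) * conj (zc s t) ^ (D - e i) := by
    rw [← pow_add]; congr 1; have := he i; omega
  rw [this]; field_simp

lemma two_pow_big (r : ℕ) (hr : 48 ≤ r) : (2 * r + 4) ^ 2 < 2 ^ r := by
  induction r, hr using Nat.le_induction with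
  | base => norm_num
  | succ n hn ih => rw [pow_succ 2]; nlinarith

/-- points where alpha is not close to one -/
lemma al_far {p y : ℕ} {s t X E : ℤ} (h : Sol p y s t X E) (hp : 100 ≤ p) (hy : 2 ≤ y)
    (hc : ‖al s t - 1‖ * (y : ℝ) ^ ((p - 1) / 2) ≤ 2 * (p : ℝ) ^ 2) : False := by
  have h1 := al_sub_one s t h.2.1
  have h2 := sol_norm h
  have ht : (1 : ℝ) ≤ |(t : ℝ)| := by exact_mod_cast Int.one_le_abs h.2.1
  have hy' : (2 : ℝ) ≤ y := by exact_mod_cast hy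
  have hz : ‖zc s t‖ ≤ y := by
    have := norm_nonneg (zc s t); nlinarith
  obtain ⟨r, hr⟩ : ∃ r, (p - 1) / 2 = r + 1 := ⟨(p - 1) / 2 - 1, by omega⟩
  rw [hr] at hc
  have h3 : (y : ℝ) ^ r ≤ p ^ 2 := by
    have h5 : 2 ≤ ‖al s t - 1‖ * y := by
      calc (2 : ℝ) ≤ 2 * |(t : ℝ)| := by linarith
        _ = _ := h1.symm
        _ ≤ _ := by gcongr
    have h6 : (0 : ℝ) < (y : ℝ) ^ r := by positivity
    have : 2 * (y : ℝ) ^ r ≤ ‖al s t - 1‖ * y * y ^ r := by gcongr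
    rw [pow_succ] at hc; nlinarith
  have h4 : (2 : ℝ) ^ r ≤ p ^ 2 := le_trans (by gcongr) h3
  have h5 : 2 ^ r ≤ p ^ 2 := by exact_mod_cast h4
  have h6 : p ≤ 2 * r + 4 := by omega
  have h8 : (2 * r + 4) ^ 2 < 2 ^ r := two_pow_big r (by omega)
  have h9 : p ^ 2 ≤ (2 * r + 4) ^ 2 := Nat.pow_le_pow_left h6 2
  omega

lemma al_pow_ne {p y : ℕ} {s t X E : ℤ} (h : Sol p y s t X E) (hpp : p.Prime) (hp : 100 ≤ p) (hy : 2 ≤ y)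
    (n : ℕ) (hn : 0 < n) (hnp : n < p) : al s t ^ n ≠ 1 := by
  intro hα
  have hcl := sol_close h (hpp.odd_of_ne_two (by omega)) (by omega)
  refine al_far h hp hy ?_
  rcases Nat.lt_or_ge 1 n with h1 | h1
  · obtain ⟨c, hc, hc2⟩ := Nat.exists_mul_mod_eq_one_of_coprime (k := n) (n := p)
      ((Nat.coprime_of_lt_prime hn.ne' hnp hpp)) h1
    have e : al s t = (al s t ^ p) ^ c := by
      rw [← pow_mul]
      conv_rhs => rw [← Nat.div_add_mod (p * c) n, hc2, pow_add, pow_mul, hα]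
      simp
    have hb := norm_pow_sub_pow_le_aux (al s t ^ p) 1 (by rw [norm_pow, al_norm s t h.2.1, one_pow]) (by simp) c
    rw [← e, one_pow] at hb
    have hcp : (c : ℝ) ≤ p := by exact_mod_cast (by omega : c ≤ p)
    calc ‖al s t - 1‖ * (y : ℝ) ^ ((p - 1) / 2) ≤ (p * ‖al s t ^ p - 1‖) * (y : ℝ) ^ ((p - 1) / 2) := by
          gcongr; exact hb.trans (by gcongr)
      _ = p * (‖al s t ^ p - 1‖ * (y : ℝ) ^ ((p - 1) / 2)) := by ring
      _ ≤ p * (2 * p) := by gcongr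
      _ = _ := by ring
  · have : n = 1 := by omega
    rw [this, pow_one] at hα
    rw [hα]; simp


lemma pow_self_le (T : ℕ) : (T : ℝ) ^ T / T.factorial ≤ Real.exp T :=
  Real.pow_div_factorial_le_exp _ (by positivity) T

lemma tail_bound (u : ℝ) (T : ℕ) (hu : 0 < u) (hT : (T : ℝ) = 250 * u) :
    (19 * u) ^ T / T.factorial ≤ Real.exp (-(250 * u)) := by
  have h1 := pow_self_le T
  have h2 : 19 * u = (19 / 250) * T := by rw [hT]; ring
  rw [h2, mul_pow, mul_div_assoc]
  have h3 : (19 / 250 : ℝ) ≤ Real.exp (-2) := by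
    rw [Real.exp_neg, le_inv_comm₀ (by norm_num) (Real.exp_pos _)]
    have := Real.exp_one_lt_d9
    have e : Real.exp 2 = Real.exp 1 * Real.exp 1 := by rw [← Real.exp_add]; norm_num
    rw [e]
    have := Real.exp_pos 1
    nlinarith
  calc (19 / 250 : ℝ) ^ T * (T ^ T / T.factorial) ≤ Real.exp (-2) ^ T * Real.exp T := by gcongr
    _ = Real.exp (-T) := by rw [← Real.exp_nat_mul, ← Real.exp_add]; congr 1; ring
    _ = _ := by rw [hT]

lemma exp_big (u : ℝ) (hu : 8000 ≤ u) : 4000 * u ≤ Real.exp u := by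
  have := Real.quadratic_le_exp_of_nonneg (by linarith : 0 ≤ u)
  nlinarith

lemma G1_bound (p M A a : ℕ) (u : ℝ) (hp : 2000 ≤ p) (hA : A = 2000 * M) (ha : a < A) (hlog : 2 * A * Real.log p ≤ u) :
    ((3 * p * M : ℝ) + a) ^ a / a.factorial ≤ Real.exp u := by
  have hp' : (2000 : ℝ) ≤ p := by exact_mod_cast hp
  have ha' : (a : ℝ) ≤ A := by exact_mod_cast ha.le
  have hA' : (A : ℝ) = 2000 * M := by rw [hA]; push_cast; ring
  have h1 : (3 * p * M : ℝ) + a ≤ p * A := by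
    rw [hA'] at ha' ⊢
    nlinarith [Nat.cast_nonneg (α := ℝ) M, mul_le_mul_of_nonneg_right hp' (Nat.cast_nonneg (α := ℝ) M)]
  have h2 : (A : ℝ) ^ a / a.factorial ≤ Real.exp A := Real.pow_div_factorial_le_exp _ (by positivity) a
  have h3 : Real.exp 1 ≤ p := by have := Real.exp_one_lt_d9; linarith
  calc ((3 * p * M : ℝ) + a) ^ a / a.factorial ≤ (p * A) ^ a / a.factorial := by gcongr
    _ = (p : ℝ) ^ a * (A ^ a / a.factorial) := by rw [mul_pow]; ring
    _ ≤ (p : ℝ) ^ A * Real.exp A := by gcongr; linarith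
    _ ≤ (p : ℝ) ^ A * p ^ A := by
        gcongr
        calc Real.exp A = Real.exp 1 ^ A := by rw [← Real.exp_nat_mul]; simp
          _ ≤ _ := by gcongr
    _ = Real.exp (2 * A * Real.log p) := by
        have e : (p : ℝ) = Real.exp (Real.log p) := (Real.exp_log (by positivity)).symm
        conv_lhs => rw [← pow_add, e, ← Real.exp_nat_mul]
        congr 1; push_cast; ring
    _ ≤ _ := Real.exp_le_exp.mpr hlog

lemma eps_bound (p y h B : ℕ) (ε : ℝ) (hy : 2 ≤ y) (hp : 100 ≤ p) (hh : (h : ℝ) ≤ 3 * Real.log y) (hh1 : 1 ≤ h)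
    (hB : 1 ≤ B)
    (hε : ε * (y : ℝ) ^ ((p - 1) / 2) ≤ 4) (hpB : 600000 * B ^ 2 ≤ p) :
    ε ≤ Real.exp (-(32 * (2000 * (B : ℝ) ^ 2 * h))) := by
  have hy0 : (0 : ℝ) < y := by positivity
  set r := (p - 1) / 2 with hr
  have e1 : (y : ℝ) ^ r = Real.exp (r * Real.log y) := by rw [Real.exp_nat_mul, Real.exp_log hy0]
  have h1 : ε ≤ 4 * Real.exp (-(r * Real.log y)) := by
    rw [Real.exp_neg, ← e1, ← div_eq_mul_inv, le_div_iff₀ (by positivity)]; exact hε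
  refine h1.trans ?_
  have h4 : (4 : ℝ) ≤ Real.exp 2 := by
    have := Real.quadratic_le_exp_of_nonneg (by norm_num : (0:ℝ) ≤ 2)
    linarith
  calc 4 * Real.exp (-(r * Real.log y)) ≤ Real.exp 2 * Real.exp (-(r * Real.log y)) := by gcongr
    _ = Real.exp (2 - r * Real.log y) := by rw [← Real.exp_add]; ring_nf
    _ ≤ _ := by
      apply Real.exp_le_exp.mpr
      have hr3 : (p : ℝ) ≤ 3 * r := by exact_mod_cast (by omega : p ≤ 3 * r)
      have hpB' : 600000 * (B : ℝ) ^ 2 ≤ p := by exact_mod_cast hpB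
      have hh1' : (1 : ℝ) ≤ h := by exact_mod_cast hh1
      have hB' : (1 : ℝ) ≤ (B : ℝ) ^ 2 := by exact_mod_cast Nat.one_le_pow _ _ hB
      have : (600000 * (B : ℝ) ^ 2) * h ≤ (3 * r) * (3 * Real.log y) := by
        apply mul_le_mul (hpB'.trans hr3) hh (by positivity) (by positivity)
      nlinarith

set_option maxHeartbeats 1600000 in
open ComplexConjugate in
lemma partA_core {p y : ℕ} {s t X E : ℤ} (h : Sol p y s t X E) (hpp : p.Prime) (hy : 2 ≤ y) (B : ℕ) (hB : 24 ≤ B)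
    (hBlog : 4000 * Real.log p ≤ B) (hpB : 600000 * B ^ 2 ≤ p) : False := by
  have hpbig : 2000 * B ≤ p := by nlinarith
  have hp0 : 0 < p := hpp.pos
  have hpR : (0 : ℝ) < p := by exact_mod_cast hp0
  set α := al s t with hαdef
  have hα1 : ‖α‖ = 1 := al_norm s t h.2.1
  obtain ⟨k, hkp, Λ, hk1, hk2, hk3⟩ := root_near α hα1 p hp0
  set ζ := Complex.exp (Complex.I * (2 * Real.pi * k / p : ℝ)) with hζ
  have hζ1 : ‖ζ‖ = 1 := by rw [hζ, Complex.norm_exp_I_mul_ofReal]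
  set ε := ‖α - ζ‖ with hεdef
  have hε0 : 0 ≤ ε := norm_nonneg _
  have hy0 : (0 : ℝ) < y := by positivity
  have hε : ε * (y : ℝ) ^ ((p - 1) / 2) ≤ 4 := by
    have h1 : ε ≤ |Λ / p| := by
      have e : α - ζ = ζ * (Complex.exp (Complex.I * (Λ / p : ℝ)) - 1) := by
        rw [mul_sub, mul_one, ← hk1]
      rw [hεdef, e, norm_mul, hζ1, one_mul]
      exact Real.norm_exp_I_mul_ofReal_sub_one_le
    rw [abs_div, Nat.abs_cast, le_div_iff₀ hpR] at h1
    have h2 := sol_close h (hpp.odd_of_ne_two (by omega)) (by omega)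
    have h3 : (ε * (y : ℝ) ^ ((p - 1) / 2)) * p ≤ 4 * p := by
      calc (ε * (y : ℝ) ^ ((p - 1) / 2)) * p = (ε * p) * (y : ℝ) ^ ((p - 1) / 2) := by ring
        _ ≤ (2 * ‖α ^ p - 1‖) * (y : ℝ) ^ ((p - 1) / 2) := mul_le_mul_of_nonneg_right (h1.trans hk3) (by positivity)
        _ = 2 * (‖α ^ p - 1‖ * (y : ℝ) ^ ((p - 1) / 2)) := by ring
        _ ≤ _ := by linarith
    exact le_of_mul_le_mul_right h3 hpR
  have hk0 : k ≠ 0 := by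
    rintro rfl
    have : ζ = 1 := by rw [hζ]; simp
    rw [hεdef, this] at hε
    refine al_far h (by omega) hy (hε.trans ?_)
    have : (2 : ℝ) ≤ p := by exact_mod_cast hpp.two_le
    nlinarith
  have hcop : Nat.Coprime k p := (Nat.coprime_of_lt_prime hk0 hkp hpp).symm
  -- the height parameter
  have hlogy : Real.log 2 ≤ Real.log y := Real.log_le_log (by norm_num) (by exact_mod_cast hy)
  have hlog2 := Real.log_two_gt_d9
  set hh : ℕ := ⌈Real.log y⌉₊ with hhdef
  have hh1 : Real.log y ≤ hh := Nat.le_ceil _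
  have hh2 : (hh : ℝ) ≤ 3 * Real.log y := by
    have := Nat.ceil_lt_add_one (by linarith : 0 ≤ Real.log y)
    linarith
  have hh3 : 1 ≤ hh := by
    rw [Nat.one_le_iff_ne_zero]; intro h0; rw [h0] at hh1; push_cast at hh1; linarith
  have hz : ‖zc s t‖ ≤ Real.exp hh := by
    have h2 := sol_norm h
    have hy' : (2 : ℝ) ≤ y := by exact_mod_cast hy
    have h3 : ‖zc s t‖ ≤ y := by
      have := norm_nonneg (zc s t); nlinarith
    refine h3.trans ?_
    rw [← Real.exp_log hy0]; exact Real.exp_le_exp.mpr hh1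
  have hz1 : 1 ≤ ‖zc s t‖ := by
    have h2 := sol_norm h
    have hy' : (2 : ℝ) ≤ y := by exact_mod_cast hy
    have := norm_nonneg (zc s t); nlinarith
  have hεu := eps_bound p y hh B ε hy (by omega) hh2 hh3 (by omega) hε hpB
  -- parameters
  set M := 2000 * B * hh with hM
  set A := 2000 * M with hA
  set T := 250 * (B * M) with hT
  set u : ℝ := (B : ℝ) * M with hu
  have hu' : u = 2000 * (B : ℝ) ^ 2 * hh := by rw [hu, hM]; push_cast; ring
  have hM0 : 0 < M := by positivity
  have hB24 : (24 : ℝ) ≤ B := by exact_mod_cast hB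
  have hh1R : (1 : ℝ) ≤ hh := by exact_mod_cast hh3
  have hu8 : 8000 ≤ u := by rw [hu']; nlinarith
  rw [← hu'] at hεu
  have hAB : ((A * B : ℕ) : ℝ) = 2000 * u := by rw [hA, hu]; push_cast; ring
  have hTu : (T : ℝ) = 250 * u := by rw [hT, hu]; push_cast; ring
  have hbig := exp_big u hu8
  obtain ⟨P, hP0, hPH, hPs⟩ := exists_aux A B T (by omega) (by positivity) (2 * Real.pi / p) (3 * p * M)
    (Real.exp (31 * u)) (Real.exp u) (19 * u) (by positivity) (by positivity)
    (by
      have := Real.pi_lt_d6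
      have e : (B : ℝ) * (2 * Real.pi / p) * (3 * p * M) = 6 * Real.pi * u := by rw [hu]; field_simp; ring
      rw [e]; nlinarith)
    (by rw [hTu]; linarith)
    (by
      intro a ha
      refine G1_bound p M A a u (by omega) hA ha ?_
      rw [hA, hu]; push_cast
      nlinarith [Nat.cast_nonneg (α := ℝ) M])
    (Real.one_le_exp (by linarith)) (Real.one_le_exp (by linarith))
    (by
      have : A * B = 2000 * (B * M) := by rw [hA]; ring
      rw [this, hT, hA]; nlinarith)
    _ rfl
  set H := Real.sqrt (2 * (A * B : ℕ) * Real.exp (31 * u) * (Real.exp u * Real.exp (19 * u))) with hH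
  have hH0 : 0 ≤ H := Real.sqrt_nonneg _
  have hHle : H ≤ Real.exp (26 * u) := by
    rw [hH, Real.sqrt_le_left (Real.exp_pos _).le]
    rw [hAB]
    have e : Real.exp (26 * u) ^ 2 = Real.exp u * Real.exp (31 * u) * (Real.exp u * Real.exp (19 * u)) := by
      rw [← Real.exp_nat_mul, ← Real.exp_add, ← Real.exp_add, ← Real.exp_add]; congr 1; push_cast; ring
    rw [e]; gcongr; linarith
  have hABe : ((A * B : ℕ) : ℝ) ≤ Real.exp u := by rw [hAB]; linarith
  apply hP0
  refine zero_est A B k p (2000 * B) M (by omega) α (by intro h0; rw [h0] at hα1; simp at hα1)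
    (fun n hn hnB => al_pow_ne h hpp (by omega) hy n hn (by omega)) hcop hp0 hpbig
    (by
      have e1 : 2000 * B * M = A * B := by rw [hA]; ring
      rw [e1]
      exact Nat.mul_lt_mul_of_pos_right (by omega) (by omega)) P ?_
  intro n hn m hm
  set x := k * n + p * m with hx
  have hxR : (x : ℝ) ≤ 3 * p * M := by
    have h1 : n ≤ 2 * M := by
      have : 2000 * B * 1 ≤ 2000 * B * hh := Nat.mul_le_mul_left _ hh3
      omega
    have h2 : x ≤ 3 * p * M := by
      calc x ≤ p * (2 * M) + p * M := by rw [hx]; gcongr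
        _ = _ := by ring
    exact_mod_cast h2
  have h1 := hPs x hxR
  set V := ∑ j, (P j : ℂ) * (x.choose j.1 : ℂ) * α ^ ((j.2 : ℕ) * n) with hV
  set V0 := ∑ j, (P j : ℂ) * (x.choose j.1 : ℂ) * Complex.exp (Complex.I * ((j.2 : ℕ) * (2 * Real.pi / p) * x : ℝ)) with hV0
  set D := B * (4000 * B) with hD
  have hbn : ∀ b : Fin B, (b : ℕ) * n ≤ D := by
    intro b
    rw [hD]; exact Nat.mul_le_mul b.2.le (by omega)
  have hDu : (D : ℝ) ≤ Real.exp u := by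
    rw [hD]; push_cast; rw [hu'] at hbig ⊢; nlinarith
  have hdiff : ‖V - V0‖ ≤ (A * B : ℕ) * (H * Real.exp u * (D * ε)) := by
    rw [hV, hV0, ← Finset.sum_sub_distrib]
    refine (norm_sum_le _ _).trans ?_
    have hci : Fintype.card (Fin A × Fin B) = A * B := by simp
    rw [← hci, ← nsmul_eq_mul, ← Finset.card_univ]
    refine Finset.sum_le_card_nsmul _ _ _ fun j _ => ?_
    have e : Complex.exp (Complex.I * ((j.2 : ℕ) * (2 * Real.pi / p) * x : ℝ)) = ζ ^ ((j.2 : ℕ) * n) := by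
      rw [hζ, ← Complex.exp_nat_mul, Complex.exp_eq_exp_iff_exists_int]
      refine ⟨(j.2 : ℕ) * m, ?_⟩
      have : (p : ℂ) ≠ 0 := by exact_mod_cast hp0.ne'
      rw [hx]; push_cast; field_simp
    rw [e, ← mul_sub, norm_mul, norm_mul]
    have h1 : ‖(P j : ℂ)‖ ≤ H := by
      rw [Complex.norm_intCast]; exact hPH j
    have h2 : ‖(x.choose j.1 : ℂ)‖ ≤ Real.exp u := by
      rw [Complex.norm_natCast]
      refine (Nat.choose_le_pow_div (j.1 : ℕ) x).trans ?_
      refine le_trans ?_ (G1_bound p M A j.1 u (by omega) hA j.1.2 ?_)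
      · gcongr
        have : (0 : ℝ) ≤ ((j.1 : ℕ) : ℝ) := by positivity
        linarith
      · rw [hA, hu]; push_cast
        nlinarith [Nat.cast_nonneg (α := ℝ) M]
    have h3 : ‖α ^ ((j.2 : ℕ) * n) - ζ ^ ((j.2 : ℕ) * n)‖ ≤ D * ε := by
      refine (norm_pow_sub_pow_le_aux α ζ hα1 hζ1 _).trans ?_
      have : (((j.2 : ℕ) * n : ℕ) : ℝ) ≤ D := by exact_mod_cast hbn j.2
      gcongr
    gcongr
  -- clear denominators
  obtain ⟨g, hg⟩ := clear_denom s t h.2.1 D (fun j => P j * (x.choose j.1 : ℤ)) (fun j : Fin A × Fin B => (j.2 : ℕ) * n)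
    (fun j => hbn j.2)
  have hg2 : GaussianInt.toComplex g = conj (zc s t) ^ D * V := by
    rw [hg, hV]; push_cast; rfl
  have hzD : ‖zc s t‖ ^ D ≤ Real.exp (2 * u) := by
    calc ‖zc s t‖ ^ D ≤ Real.exp hh ^ D := by gcongr
      _ = Real.exp (2 * u) := by
        rw [← Real.exp_nat_mul, hD, hu']; congr 1; push_cast; ring
  have hVle : ‖V‖ ≤ Real.exp (-(3 * u)) * 3 := by
    have e1 : (A + T) * (2 * ((A * B : ℕ) * H) / Real.exp (31 * u)) ≤ Real.exp (-(3 * u)) := by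
      have hAT : (A + T : ℝ) ≤ Real.exp u := by
        refine le_trans ?_ hABe
        rw [hAB, hTu, hA, hu]; push_cast; nlinarith [Nat.cast_nonneg (α := ℝ) M]
      calc (A + T : ℝ) * (2 * ((A * B : ℕ) * H) / Real.exp (31 * u))
          = (A + T) * (2 * (A * B : ℕ)) * H * Real.exp (-(31 * u)) := by rw [Real.exp_neg]; ring
        _ ≤ Real.exp u * Real.exp u * Real.exp (26 * u) * Real.exp (-(31 * u)) := by
          gcongr
          rw [hAB]; linarith
        _ = _ := by rw [← Real.exp_add, ← Real.exp_add, ← Real.exp_add]; congr 1; ring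
    have e2 : (A * B : ℕ) * (H * Real.exp u * ((19 * u) ^ T / T.factorial * 2)) ≤ Real.exp (-(3 * u)) := by
      calc (A * B : ℕ) * (H * Real.exp u * ((19 * u) ^ T / T.factorial * 2))
          = (2 * (A * B : ℕ)) * H * Real.exp u * ((19 * u) ^ T / T.factorial) := by ring
        _ ≤ Real.exp u * Real.exp (26 * u) * Real.exp u * Real.exp (-(250 * u)) := by
          gcongr
          · rw [hAB]; linarith
          · exact tail_bound u T (by linarith) hTu
        _ = Real.exp (-(222 * u)) := by rw [← Real.exp_add, ← Real.exp_add, ← Real.exp_add]; congr 1; ring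
        _ ≤ _ := by apply Real.exp_le_exp.mpr; linarith
    have e3 : (A * B : ℕ) * (H * Real.exp u * (D * ε)) ≤ Real.exp (-(3 * u)) := by
      calc (A * B : ℕ) * (H * Real.exp u * (D * ε)) ≤
          Real.exp u * (Real.exp (26 * u) * Real.exp u * (Real.exp u * Real.exp (-(32 * u)))) := by gcongr
        _ = _ := by rw [← Real.exp_add, ← Real.exp_add, ← Real.exp_add, ← Real.exp_add]; congr 1; ring
    calc ‖V‖ = ‖(V - V0) + V0‖ := by rw [sub_add_cancel]
      _ ≤ _ := norm_add_le _ _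
      _ ≤ _ := by linarith
  have hg0 : g = 0 := by
    apply gauss_small
    rw [hg2, norm_mul, norm_pow, Complex.norm_conj]
    calc ‖zc s t‖ ^ D * ‖V‖ ≤ Real.exp (2 * u) * (Real.exp (-(3 * u)) * 3) := by gcongr
      _ = 3 * Real.exp (-u) := by rw [← mul_assoc, ← Real.exp_add, mul_comm]; congr 2; ring
      _ < 1 := by
        rw [Real.exp_neg, ← div_eq_mul_inv, div_lt_one (Real.exp_pos _)]; linarith
  rw [hg0, map_zero] at hg2
  rcases mul_eq_zero.mp hg2.symm with h0 | h0
  · exact absurd h0 (pow_ne_zero _ ((map_ne_zero _).mpr (zc_ne s t h.2.1)))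
  · exact h0

lemma partA : ∃ P0 : ℕ, ∀ p y : ℕ, ∀ s t X E : ℤ, p.Prime → P0 ≤ p → 2 ≤ y → ¬ Sol p y s t X E := by
  refine ⟨10 ^ 30, fun p y s t X E hpp hp hy h => ?_⟩
  have hp' : (10 : ℝ) ^ 30 ≤ p := by exact_mod_cast hp
  have hp0 : (0 : ℝ) < p := by linarith [show (0:ℝ) < 10 ^ 30 by norm_num]
  set w : ℝ := (p : ℝ) ^ (1 / 4 : ℝ) with hw
  have hw4 : w ^ 4 = p := by
    rw [hw, ← Real.rpow_natCast, ← Real.rpow_mul hp0.le]; norm_num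
  have hw0 : 0 ≤ w := by positivity
  have hlog : Real.log p ≤ 4 * w := by
    have := Real.log_le_rpow_div hp0.le (by norm_num : (0 : ℝ) < 1 / 4)
    rw [← hw] at this; linarith
  have hlog0 : 0 ≤ Real.log p := Real.log_nonneg (by linarith [show (1:ℝ) < 10 ^ 30 by norm_num])
  have hw2 : (10 : ℝ) ^ 15 ≤ w ^ 2 := by
    have : ((10 : ℝ) ^ 15) ^ 2 ≤ (w ^ 2) ^ 2 := by
      calc ((10 : ℝ) ^ 15) ^ 2 = (10 : ℝ) ^ 30 := by norm_num
        _ ≤ (p : ℝ) := hp'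
        _ = _ := by rw [← hw4]; ring
    exact (pow_le_pow_iff_left₀ (by positivity) (by positivity) (by norm_num)).mp this
  have hw1 : 1 ≤ w := by nlinarith
  set B := ⌈4000 * Real.log p⌉₊ + 24 with hBdef
  have h1 := Nat.le_ceil (4000 * Real.log p)
  have h2 := Nat.ceil_lt_add_one (by positivity : 0 ≤ 4000 * Real.log p)
  have hB : (B : ℝ) ≤ 16025 * w := by rw [hBdef]; push_cast; linarith
  refine partA_core h hpp hy B (by omega) (by rw [hBdef]; push_cast; linarith) ?_
  have : 600000 * (B : ℝ) ^ 2 ≤ p := by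
    calc 600000 * (B : ℝ) ^ 2 ≤ 600000 * (16025 * w) ^ 2 := by gcongr
      _ = (600000 * 16025 ^ 2) * w ^ 2 := by ring
      _ ≤ w ^ 2 * w ^ 2 := by gcongr; refine le_trans ?_ hw2; norm_num
      _ = p := by rw [← hw4]; ring
  exact_mod_cast this


/-- product of `n` consecutive terms of the progression `p l - 1` -/
def apP (p : ℕ) (a : ℤ) (n : ℕ) : ℤ := ∏ l ∈ Finset.range n, ((p : ℤ) * (a + l) - 1)

lemma apP_add (p : ℕ) (a : ℤ) (m n : ℕ) : apP p a (m + n) = apP p a m * apP p (a + m) n := by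
  rw [apP, Finset.prod_range_add]
  congr 1
  refine Finset.prod_congr rfl fun l _ => ?_
  push_cast; ring

lemma apP_ne (p : ℕ) (hp : 2 ≤ p) (a : ℤ) (n : ℕ) : apP p a n ≠ 0 := by
  rw [apP, Finset.prod_ne_zero_iff]
  intro l _ h
  have h1 : (p : ℤ) ∣ 1 := ⟨a + l, by linarith⟩
  have := Int.le_of_dvd (by norm_num) h1
  omega

lemma fact_dvd_consec (a : ℤ) (n : ℕ) : (n.factorial : ℤ) ∣ ∏ l ∈ Finset.range n, (a + l) := by
  have h := Ring.factorial_nsmul_multichoose_eq_ascPochhammer (R := ℤ) a n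
  rw [Polynomial.ascPochhammer_smeval_eq_eval] at h
  have e : ∀ n : ℕ, (ascPochhammer ℤ n).eval a = ∏ l ∈ Finset.range n, (a + l) := by
    intro n
    induction n with
    | zero => simp
    | succ n ih => rw [ascPochhammer_succ_eval, ih, Finset.prod_range_succ]
  rw [e] at h
  exact ⟨Ring.multichoose a n, by rw [← h]; simp⟩

lemma fact_dvd_apP (p : ℕ) (hp : p.Prime) (a : ℤ) (n : ℕ) : (n.factorial : ℤ) ∣ (p : ℤ) ^ n * apP p a n := by
  obtain ⟨v, m, hm, hv⟩ := Nat.exists_eq_pow_mul_and_not_dvd n.factorial_ne_zero p hp.ne_one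
  have hvn : v ≤ n := by
    by_contra hcon
    have h2 : p ^ (n + 1) ∣ n.factorial := (pow_dvd_pow p (by omega)).trans ⟨m, hv⟩
    have h3 := sub_one_mul_padicValNat_factorial (p := p) (hp := ⟨hp⟩) n
    have h4 : n + 1 ≤ padicValNat p n.factorial := by
      haveI := Fact.mk hp
      exact (padicValNat_dvd_iff_le n.factorial_ne_zero).mp h2
    have := hp.two_le
    have : 1 * (n + 1) ≤ (p - 1) * padicValNat p n.factorial := Nat.mul_le_mul (by omega) h4
    omega
  rw [hv]; push_cast
  refine mul_dvd_mul (pow_dvd_pow _ hvn) ?_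
  have hcop : IsCoprime (p : ℤ) (m : ℤ) := by
    rw [Nat.isCoprime_iff_coprime]; exact (Nat.Prime.coprime_iff_not_dvd hp).mpr hm
  obtain ⟨c, d, hcd⟩ := hcop
  have h1 : (m : ℤ) ∣ c ^ n * apP p a n := by
    have h2 : (m : ℤ) ∣ ∏ l ∈ Finset.range n, ((a - c) + l) := by
      refine dvd_trans ?_ (fact_dvd_consec (a - c) n)
      rw [hv]; push_cast; exact dvd_mul_left _ _
    have h3 : ∏ l ∈ Finset.range n, ((a - c) + l) ≡ c ^ n * apP p a n [ZMOD m] := by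
      have e : c ^ n * apP p a n = ∏ l ∈ Finset.range n, (c * ((p : ℤ) * (a + l) - 1)) := by
        rw [Finset.prod_mul_distrib, apP]; simp
      rw [e]
      refine Int.ModEq.prod fun l _ => ?_
      rw [Int.modEq_iff_dvd]
      refine ⟨-(d * (a + l)), ?_⟩
      have : c * ((p : ℤ) * (a + l) - 1) = (c * p) * (a + l) - c := by ring
      rw [this, show c * (p : ℤ) = 1 - d * m by linarith]; ring
    exact (Int.ModEq.dvd_iff h3).mp h2
  have hcm : IsCoprime (m : ℤ) (c ^ n) := by
    apply IsCoprime.pow_right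
    exact ⟨d, p, by linarith⟩
  exact hcm.dvd_of_dvd_mul_left h1

lemma apP_bound (p : ℕ) (a : ℤ) (n : ℕ) (R : ℝ) (hR : 0 ≤ R) (h : ∀ l < n, |(a + l : ℝ)| ≤ R) :
    |(apP p a n : ℝ)| / n.factorial ≤ Real.exp (p * R + 1) := by
  refine le_trans ?_ (Real.pow_div_factorial_le_exp (p * R + 1) (by positivity) n)
  gcongr
  rw [apP]; push_cast
  rw [Finset.abs_prod]
  calc _ ≤ ∏ l ∈ Finset.range n, (p * R + 1) := by
        refine Finset.prod_le_prod (fun _ _ => abs_nonneg _) fun l hl => ?_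
        refine (abs_sub _ _).trans ?_
        rw [abs_mul, abs_one, Nat.abs_cast]
        have := h l (by simpa using hl)
        gcongr
    _ = _ := by simp

lemma prod_erase_fact (j k : ℕ) :
    ∃ e : ℤ, |e| = 1 ∧ ∏ x ∈ (Finset.range (j + 1 + k)).erase j, ((j : ℂ) - x) = e * (j.factorial * k.factorial) := by
  refine ⟨(-1) ^ k, by simp, ?_⟩
  have h1 : ∏ x ∈ (Finset.range (j + 1 + k)).erase j, ((j : ℂ) - x) =
      ∏ x ∈ Finset.range (j + 1 + k), (if x = j then 1 else ((j : ℂ) - x)) := by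
    rw [← Finset.mul_prod_erase (Finset.range (j + 1 + k)) _ (Finset.mem_range.mpr (by omega : j < j + 1 + k))]
    simp only [if_true, one_mul]
    refine Finset.prod_congr rfl fun x hx => ?_
    rw [if_neg (Finset.ne_of_mem_erase hx)]
  rw [h1, Finset.prod_range_add, Finset.prod_range_succ, if_pos rfl, mul_one]
  have h2 : ∏ x ∈ Finset.range j, (if x = j then 1 else ((j : ℂ) - x)) = j.factorial := by
    rw [← Finset.prod_range_add_one_eq_factorial, ← Finset.prod_range_reflect]
    push_cast
    refine Finset.prod_congr rfl fun x hx => ?_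
    have hx := Finset.mem_range.mp hx
    rw [if_neg (by omega)]
    have : ((j - 1 - x : ℕ) : ℂ) = j - 1 - x := by
      rw [Nat.cast_sub (by omega), Nat.cast_sub (by omega)]; simp
    rw [this]; ring
  have h3 : ∏ x ∈ Finset.range k, (if j + 1 + x = j then 1 else ((j : ℂ) - (j + 1 + x : ℕ))) = (-1) ^ k * k.factorial := by
    rw [← Finset.prod_range_add_one_eq_factorial]
    push_cast
    have : ((-1 : ℂ)) ^ k = ∏ x ∈ Finset.range k, (-1) := by simp
    rw [this, ← Finset.prod_mul_distrib]
    refine Finset.prod_congr rfl fun x hx => ?_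
    rw [if_neg (by omega)]; ring
  rw [h2, h3]; push_cast; ring


noncomputable def Cp (p : ℕ) : ℝ := (p : ℝ) ^ 3 * Real.exp (4 * p + 2)

lemma abs_le_of_fact {p n : ℕ} {a N : ℤ} (R : ℝ) (hR : 0 ≤ R) (h : ∀ l < n, |(a + l : ℝ)| ≤ R)
    (hN : (p : ℤ) ^ n * apP p a n = n.factorial * N) : |(N : ℝ)| ≤ (p : ℝ) ^ n * Real.exp (p * R + 1) := by
  have h1 := apP_bound p a n R hR h
  have hf : (0 : ℝ) < n.factorial := by exact_mod_cast n.factorial_pos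
  have h2 : (p : ℝ) ^ n * apP p a n = n.factorial * N := by exact_mod_cast hN
  have h3 : (N : ℝ) = (p : ℝ) ^ n * apP p a n / n.factorial := by rw [h2]; field_simp
  rw [h3, abs_div, abs_mul, abs_of_pos hf, abs_of_nonneg (by positivity : (0 : ℝ) ≤ (p : ℝ) ^ n), mul_div_assoc]
  gcongr

lemma coef_bound {p r n1 n2 n3 : ℕ} {n e N1 N2 : ℤ} (hp : 1 ≤ p) (hr : 1 ≤ r) (he : |e| = 1)
    (hn : n = e * p ^ n3 * N1 * N2) (hs : n1 + n2 + n3 ≤ 3 * r)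
    (h1 : |(N1 : ℝ)| ≤ (p : ℝ) ^ n1 * Real.exp (p * (2 * r) + 1))
    (h2 : |(N2 : ℝ)| ≤ (p : ℝ) ^ n2 * Real.exp (p * (2 * r) + 1)) : |(n : ℝ)| ≤ Cp p ^ r := by
  have hp' : (1 : ℝ) ≤ p := by exact_mod_cast hp
  have hr' : (1 : ℝ) ≤ r := by exact_mod_cast hr
  have he' : |(e : ℝ)| = 1 := by exact_mod_cast he
  rw [hn]; push_cast
  rw [abs_mul, abs_mul, abs_mul, he', one_mul, abs_of_nonneg (by positivity : (0 : ℝ) ≤ (p : ℝ) ^ n3)]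
  calc (p : ℝ) ^ n3 * |(N1 : ℝ)| * |(N2 : ℝ)| ≤ (p : ℝ) ^ n3 * ((p : ℝ) ^ n1 * Real.exp (p * (2 * r) + 1)) * ((p : ℝ) ^ n2 * Real.exp (p * (2 * r) + 1)) := by gcongr
    _ = (p : ℝ) ^ (n1 + n2 + n3) * Real.exp (4 * p * r + 2) := by
      have e : Real.exp (4 * p * r + 2) = Real.exp (p * (2 * r) + 1) * Real.exp (p * (2 * r) + 1) := by
        rw [← Real.exp_add]; congr 1; ring
      rw [e, pow_add, pow_add]; ring
    _ ≤ (p : ℝ) ^ (3 * r) * Real.exp (r * (4 * p + 2)) := by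
      gcongr
      nlinarith
    _ = _ := by rw [Cp, mul_pow, pow_mul, Real.exp_nat_mul]

lemma prod_left (p r' j : ℕ) (hp : 0 < p) :
    ∏ i ∈ Finset.range (r' + 1), ((j : ℂ) - (i + 1 / p)) = (apP p ((j : ℤ) - r') (r' + 1) : ℂ) / p ^ (r' + 1) := by
  have hpC : (p : ℂ) ≠ 0 := by exact_mod_cast hp.ne'
  rw [eq_div_iff (by positivity), apP, ← Finset.prod_range_reflect]
  push_cast
  have : (p : ℂ) ^ (r' + 1) = ∏ i ∈ Finset.range (r' + 1), (p : ℂ) := by simp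
  rw [this, ← Finset.prod_mul_distrib]
  refine Finset.prod_congr rfl fun i hi => ?_
  have hi := Finset.mem_range.mp hi
  have : ((r' - i : ℕ) : ℂ) = r' - i := Nat.cast_sub (by omega)
  rw [this]; field_simp; ring

lemma prod_right (p r i : ℕ) (hp : 0 < p) :
    ∏ j ∈ Finset.range (r + 1), (((i : ℂ) + 1 / p) - j) = (-1) ^ (r + 1) * (apP p (-(i : ℤ)) (r + 1) : ℂ) / p ^ (r + 1) := by
  have hpC : (p : ℂ) ≠ 0 := by exact_mod_cast hp.ne'
  rw [eq_div_iff (by positivity), apP]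
  push_cast
  have h1 : (p : ℂ) ^ (r + 1) = ∏ i ∈ Finset.range (r + 1), (p : ℂ) := by simp
  have h2 : (-1 : ℂ) ^ (r + 1) = ∏ i ∈ Finset.range (r + 1), (-1 : ℂ) := by simp
  rw [h1, h2, ← Finset.prod_mul_distrib, ← Finset.prod_mul_distrib]
  refine Finset.prod_congr rfl fun j hj => ?_
  field_simp; ring

lemma coef_left (p : ℕ) (hp : p.Prime) (r r' j : ℕ) (hr' : r' ≤ r) (hr : 1 ≤ r) (hj : j ≤ r) :
    ∃ n : ℤ, n ≠ 0 ∧ |(n : ℝ)| ≤ Cp p ^ r ∧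
      ((p : ℂ) ^ r * (apP p (-(r' : ℤ)) (r + r' + 1) : ℂ)) /
        ((∏ x ∈ (Finset.range (r + 1)).erase j, ((j : ℂ) - x)) * ∏ i ∈ Finset.range (r' + 1), ((j : ℂ) - (i + 1 / p))) = n := by
  obtain ⟨k, hk⟩ : ∃ k, r = j + k := ⟨r - j, by omega⟩
  obtain ⟨e, he, hfac⟩ := prod_erase_fact j k
  obtain ⟨N1, hN1⟩ := fact_dvd_apP p hp (-(r' : ℤ)) j
  obtain ⟨N2, hN2⟩ := fact_dvd_apP p hp ((j : ℤ) + 1) k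
  have hp0 : (p : ℂ) ≠ 0 := by exact_mod_cast hp.ne_zero
  have hpZ : (p : ℤ) ≠ 0 := by exact_mod_cast hp.ne_zero
  have he2 : e * e = 1 := by rw [← abs_mul_abs_self, he]; norm_num
  have he0 : e ≠ 0 := by rintro rfl; simp at he
  have hsplit : apP p (-(r' : ℤ)) (r + r' + 1) = apP p (-(r' : ℤ)) j * apP p ((j : ℤ) - r') (r' + 1) * apP p ((j : ℤ) + 1) k := by
    rw [show r + r' + 1 = j + (r' + 1) + k by omega, apP_add, apP_add]
    congr 2 <;> push_cast <;> ring_nf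
  have hN10 : N1 ≠ 0 := by
    rintro rfl
    rw [mul_zero] at hN1
    exact mul_ne_zero (pow_ne_zero _ hpZ) (apP_ne p hp.two_le _ _) hN1
  have hN20 : N2 ≠ 0 := by
    rintro rfl
    rw [mul_zero] at hN2
    exact mul_ne_zero (pow_ne_zero _ hpZ) (apP_ne p hp.two_le _ _) hN2
  have hrR : (r' : ℝ) ≤ r := by exact_mod_cast hr'
  refine ⟨e * p ^ (r' + 1) * N1 * N2, by simp [he0, hp.ne_zero, hN10, hN20], ?_, ?_⟩
  · refine coef_bound (n1 := j) (n2 := k) (n3 := r' + 1) hp.one_le hr he rfl (by omega)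
      (abs_le_of_fact _ (by positivity) ?_ hN1) (abs_le_of_fact _ (by positivity) ?_ hN2)
    · intro l hl
      have hl' : (l : ℝ) ≤ r := by exact_mod_cast (by omega : l ≤ r)
      have := Nat.cast_nonneg (α := ℝ) l
      have := Nat.cast_nonneg (α := ℝ) r'
      push_cast
      rw [abs_le]; constructor <;> linarith
    · intro l hl
      have hl' : (j + 1 + l : ℝ) ≤ r := by exact_mod_cast (by omega : j + 1 + l ≤ r)
      push_cast
      rw [abs_of_nonneg (by positivity)]
      have := Nat.cast_nonneg (α := ℝ) r
      linarith
  · rw [show r + 1 = j + 1 + k by omega, hfac, prod_left p r' j hp.pos, hsplit]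
    have h1 : (p : ℂ) ^ j * apP p (-(r' : ℤ)) j = j.factorial * N1 := by exact_mod_cast hN1
    have h2 : (p : ℂ) ^ k * apP p ((j : ℤ) + 1) k = k.factorial * N2 := by exact_mod_cast hN2
    have hQ : (apP p ((j : ℤ) - r') (r' + 1) : ℂ) ≠ 0 := by exact_mod_cast apP_ne p hp.two_le _ _
    have heC : (e : ℂ) ≠ 0 := by exact_mod_cast he0
    have he2C : (e : ℂ) * e = 1 := by exact_mod_cast he2
    have hf1 : (j.factorial : ℂ) ≠ 0 := by exact_mod_cast j.factorial_ne_zero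
    have hf2 : (k.factorial : ℂ) ≠ 0 := by exact_mod_cast k.factorial_ne_zero
    rw [div_eq_iff (mul_ne_zero (mul_ne_zero heC (mul_ne_zero hf1 hf2)) (div_ne_zero hQ (pow_ne_zero _ hp0)))]
    push_cast
    calc (p : ℂ) ^ r * (apP p (-(r' : ℤ)) j * apP p ((j : ℤ) - r') (r' + 1) * apP p ((j : ℤ) + 1) k)
        = ((p : ℂ) ^ j * apP p (-(r' : ℤ)) j) * ((p : ℂ) ^ k * apP p ((j : ℤ) + 1) k) * apP p ((j : ℤ) - r') (r' + 1) := by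
          rw [hk, pow_add]; ring
      _ = (j.factorial * N1) * (k.factorial * N2) * (e * e) * apP p ((j : ℤ) - r') (r' + 1) := by rw [h1, h2, he2C]; ring
      _ = _ := by field_simp

lemma coef_right (p : ℕ) (hp : p.Prime) (r r' i : ℕ) (hr' : r' ≤ r) (hr : 1 ≤ r) (hi : i ≤ r') :
    ∃ n : ℤ, n ≠ 0 ∧ |(n : ℝ)| ≤ Cp p ^ r ∧
      ((p : ℂ) ^ r * (apP p (-(r' : ℤ)) (r + r' + 1) : ℂ)) /
        ((∏ j ∈ Finset.range (r + 1), (((i : ℂ) + 1 / p) - j)) * ∏ x ∈ (Finset.range (r' + 1)).erase i, ((i : ℂ) - x)) = n := by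
  obtain ⟨k, hk⟩ : ∃ k, r' = i + k := ⟨r' - i, by omega⟩
  obtain ⟨e, he, hfac⟩ := prod_erase_fact i k
  obtain ⟨N1, hN1⟩ := fact_dvd_apP p hp (-(r' : ℤ)) k
  obtain ⟨N2, hN2⟩ := fact_dvd_apP p hp ((r : ℤ) + 1 - i) i
  have hp0 : (p : ℂ) ≠ 0 := by exact_mod_cast hp.ne_zero
  have hpZ : (p : ℤ) ≠ 0 := by exact_mod_cast hp.ne_zero
  have he2 : e * e = 1 := by rw [← abs_mul_abs_self, he]; norm_num
  have he0 : e ≠ 0 := by rintro rfl; simp at he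
  have hsplit : apP p (-(r' : ℤ)) (r + r' + 1) = apP p (-(r' : ℤ)) k * apP p (-(i : ℤ)) (r + 1) * apP p ((r : ℤ) + 1 - i) i := by
    rw [show r + r' + 1 = k + (r + 1) + i by omega, apP_add, apP_add]
    congr 2 <;> rw [hk] <;> push_cast <;> ring_nf
  have hN10 : N1 ≠ 0 := by
    rintro rfl
    rw [mul_zero] at hN1
    exact mul_ne_zero (pow_ne_zero _ hpZ) (apP_ne p hp.two_le _ _) hN1
  have hN20 : N2 ≠ 0 := by
    rintro rfl
    rw [mul_zero] at hN2
    exact mul_ne_zero (pow_ne_zero _ hpZ) (apP_ne p hp.two_le _ _) hN2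
  have hrR : (r' : ℝ) ≤ r := by exact_mod_cast hr'
  refine ⟨(e * (-1) ^ (r + 1)) * p ^ (r + 1 + (r - r')) * N1 * N2, by simp [he0, hp.ne_zero, hN10, hN20], ?_, ?_⟩
  · refine coef_bound (n1 := k) (n2 := i) (n3 := r + 1 + (r - r')) hp.one_le hr (by rw [abs_mul, he]; simp) rfl (by omega)
      (abs_le_of_fact _ (by positivity) ?_ hN1) (abs_le_of_fact _ (by positivity) ?_ hN2)
    · intro l hl
      have hl' : (l : ℝ) ≤ r := by exact_mod_cast (by omega : l ≤ r)
      have := Nat.cast_nonneg (α := ℝ) l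
      have := Nat.cast_nonneg (α := ℝ) r'
      push_cast
      rw [abs_le]; constructor <;> linarith
    · intro l hl
      have hl' : (l + 1 : ℝ) ≤ i := by exact_mod_cast (by omega : l + 1 ≤ i)
      have hi' : (i : ℝ) ≤ r := by exact_mod_cast (by omega : i ≤ r)
      have := Nat.cast_nonneg (α := ℝ) l
      push_cast
      rw [abs_le]; constructor <;> linarith
  · rw [show r' + 1 = i + 1 + k by omega, hfac, prod_right p r i hp.pos, hsplit]
    have h1 : (p : ℂ) ^ k * apP p (-(r' : ℤ)) k = k.factorial * N1 := by exact_mod_cast hN1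
    have h2 : (p : ℂ) ^ i * apP p ((r : ℤ) + 1 - i) i = i.factorial * N2 := by exact_mod_cast hN2
    have hQ : (apP p (-(i : ℤ)) (r + 1) : ℂ) ≠ 0 := by exact_mod_cast apP_ne p hp.two_le _ _
    have heC : (e : ℂ) ≠ 0 := by exact_mod_cast he0
    have he2C : (e : ℂ) * e = 1 := by exact_mod_cast he2
    have hm : (-1 : ℂ) ^ (r + 1) * (-1) ^ (r + 1) = 1 := by rw [← mul_pow]; simp
    have hm0 : (-1 : ℂ) ^ (r + 1) ≠ 0 := by simp
    have hf1 : (i.factorial : ℂ) ≠ 0 := by exact_mod_cast i.factorial_ne_zero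
    have hf2 : (k.factorial : ℂ) ≠ 0 := by exact_mod_cast k.factorial_ne_zero
    rw [div_eq_iff (mul_ne_zero (div_ne_zero (mul_ne_zero hm0 hQ) (pow_ne_zero _ hp0)) (mul_ne_zero heC (mul_ne_zero hf1 hf2)))]
    push_cast
    generalize (-1 : ℂ) ^ (r + 1) = σ at *
    calc (p : ℂ) ^ r * (apP p (-(r' : ℤ)) k * apP p (-(i : ℤ)) (r + 1) * apP p ((r : ℤ) + 1 - i) i)
        = (p : ℂ) ^ (r - r') * ((p : ℂ) ^ k * apP p (-(r' : ℤ)) k) * ((p : ℂ) ^ i * apP p ((r : ℤ) + 1 - i) i) * apP p (-(i : ℤ)) (r + 1) := by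
          have : (p : ℂ) ^ r = (p : ℂ) ^ (r - r') * (p : ℂ) ^ k * (p : ℂ) ^ i := by
            rw [← pow_add, ← pow_add]; congr 1; omega
          rw [this]; ring
      _ = (p : ℂ) ^ (r - r') * (k.factorial * N1) * (i.factorial * N2) * (e * e) * (σ * σ) * apP p (-(i : ℤ)) (r + 1) := by rw [h1, h2, he2C, hm]; ring
      _ = _ := by rw [pow_add (p : ℂ) (r + 1)]; field_simp


/-- Interpolation identity giving the Padé coefficients. -/
lemma pade1 (p : ℕ) (hp : p.Prime) (r r' : ℕ) (hr' : r' ≤ r) (hr : 1 ≤ r) :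
    ∃ a b : ℕ → ℤ, (∀ j, |(a j : ℝ)| ≤ Cp p ^ r) ∧ (∀ i, |(b i : ℝ)| ≤ Cp p ^ r) ∧ a r ≠ 0 ∧ b r' ≠ 0 ∧
      (∀ i, r' < i → b i = 0) ∧
      ∀ q : Polynomial ℂ, q.natDegree < r + r' + 1 →
        ∑ j ∈ Finset.range (r + 1), (a j : ℂ) * q.eval (j : ℂ) +
        ∑ i ∈ Finset.range (r + 1), (b i : ℂ) * q.eval ((i : ℂ) + 1 / p) = 0 := by
  classical
  have hp0 : (p : ℂ) ≠ 0 := by exact_mod_cast hp.ne_zero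
  have hL : ∀ j : ℕ, ∃ n : ℤ, |(n : ℝ)| ≤ Cp p ^ r ∧ (j ≤ r → n ≠ 0 ∧
      ((p : ℂ) ^ r * (apP p (-(r' : ℤ)) (r + r' + 1) : ℂ)) /
        ((∏ x ∈ (Finset.range (r + 1)).erase j, ((j : ℂ) - x)) * ∏ i ∈ Finset.range (r' + 1), ((j : ℂ) - (i + 1 / p))) = n) := by
    intro j
    by_cases hj : j ≤ r
    · obtain ⟨n, h1, h2, h3⟩ := coef_left p hp r r' j hr' hr hj
      exact ⟨n, h2, fun _ => ⟨h1, h3⟩⟩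
    · exact ⟨0, by simpa using pow_nonneg (by unfold Cp; positivity) r, fun h => absurd h hj⟩
  have hR : ∀ i : ℕ, ∃ n : ℤ, |(n : ℝ)| ≤ Cp p ^ r ∧ (r' < i → n = 0) ∧ (i ≤ r' → n ≠ 0 ∧
      ((p : ℂ) ^ r * (apP p (-(r' : ℤ)) (r + r' + 1) : ℂ)) /
        ((∏ j ∈ Finset.range (r + 1), (((i : ℂ) + 1 / p) - j)) * ∏ x ∈ (Finset.range (r' + 1)).erase i, ((i : ℂ) - x)) = n) := by
    intro i
    by_cases hi : i ≤ r'
    · obtain ⟨n, h1, h2, h3⟩ := coef_right p hp r r' i hr' hr hi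
      exact ⟨n, h2, fun h => by omega, fun _ => ⟨h1, h3⟩⟩
    · exact ⟨0, by simpa using pow_nonneg (by unfold Cp; positivity) r, fun _ => rfl, fun h => absurd h hi⟩
  choose a ha ha' using hL
  choose b hb hb0 hb' using hR
  refine ⟨a, b, ha, hb, (ha' r le_rfl).1, (hb' r' le_rfl).1, hb0, ?_⟩
  intro q hq
  set s : Finset (ℕ ⊕ ℕ) := (Finset.range (r + 1)).disjSum (Finset.range (r' + 1)) with hs
  set v : ℕ ⊕ ℕ → ℂ := Sum.elim (fun j => (j : ℂ)) (fun i => (i : ℂ) + 1 / p) with hv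
  have key : ∀ i j : ℕ, (i : ℂ) + 1 / p ≠ j := by
    intro i j h
    have h1 : (i : ℂ) * p + 1 = j * p := by field_simp at h; linear_combination h
    have h2 : i * p + 1 = j * p := by exact_mod_cast h1
    have h3 : p ∣ 1 := (Nat.dvd_add_right (dvd_mul_left p i)).mp (h2 ▸ dvd_mul_left p j)
    exact hp.one_lt.ne' (Nat.dvd_one.mp h3)
  have hinj : Set.InjOn v s := by
    rintro (x | x) _ (y | y) _ hxy
    · simp [hv] at hxy; rw [hxy]
    · simp only [hv, Sum.elim_inl, Sum.elim_inr] at hxy; exact absurd hxy.symm (key _ _)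
    · simp only [hv, Sum.elim_inl, Sum.elim_inr] at hxy; exact absurd hxy (key _ _)
    · simp [hv] at hxy; rw [hxy]
  have hcard : s.card = r + r' + 2 := by simp [hs]; omega
  have hco := Lagrange.coeff_eq_sum hinj (P := q) (lt_of_le_of_lt Polynomial.degree_le_natDegree (by
    rw [hcard]; exact_mod_cast (by omega : q.natDegree < r + r' + 2)))
  rw [hcard, Polynomial.coeff_eq_zero_of_natDegree_lt (by omega), hs, Finset.sum_disjSum] at hco
  have el : ∀ j, ((Finset.range (r + 1)).disjSum (Finset.range (r' + 1))).erase (Sum.inl j) =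
      ((Finset.range (r + 1)).erase j).disjSum (Finset.range (r' + 1)) := by
    intro j; ext (x | x) <;> simp
  have er : ∀ j, ((Finset.range (r + 1)).disjSum (Finset.range (r' + 1))).erase (Sum.inr j) =
      (Finset.range (r + 1)).disjSum ((Finset.range (r' + 1)).erase j) := by
    intro j; ext (x | x) <;> simp
  simp only [el, er, Finset.prod_disjSum, hv, Sum.elim_inl, Sum.elim_inr, add_sub_add_right_eq_sub] at hco
  have hB : ∑ i ∈ Finset.range (r + 1), (b i : ℂ) * q.eval ((i : ℂ) + 1 / p) =
      ∑ i ∈ Finset.range (r' + 1), (b i : ℂ) * q.eval ((i : ℂ) + 1 / p) := by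
    symm
    refine Finset.sum_subset (by intro x; simp; omega) fun i _ hi => ?_
    rw [hb0 i (by simpa using hi)]; simp
  rw [hB]
  have h2 := congrArg (fun z => ((p : ℂ) ^ r * (apP p (-(r' : ℤ)) (r + r' + 1) : ℂ)) * z) hco
  simp only [mul_zero, mul_add, Finset.mul_sum] at h2
  rw [h2]
  congr 1
  · refine Finset.sum_congr rfl fun j hj => ?_
    rw [← (ha' j (by have := Finset.mem_range.mp hj; omega)).2]; ring
  · refine Finset.sum_congr rfl fun j hj => ?_
    rw [← (hb' j (by have := Finset.mem_range.mp hj; omega)).2]; ring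


lemma exp_rem (r : ℕ) (hr : 1 ≤ r) (θ ν : ℝ) (hθ : |θ| ≤ 1 / 2) (h0 : 0 ≤ ν) (hν : ν ≤ r + 1) :
    ‖Complex.exp (Complex.I * θ * ν) - ∑ m ∈ Finset.range (2 * r), (Complex.I * θ * ν) ^ m / m.factorial‖
      ≤ 2 * Real.exp (r + 1) * |θ| ^ (2 * r) := by
  have hr' : (1 : ℝ) ≤ r := by exact_mod_cast hr
  have hn : ‖Complex.I * θ * ν‖ = |θ| * ν := by
    simp [abs_of_nonneg h0]
  have h1 := Complex.exp_bound' (x := Complex.I * θ * ν) (n := 2 * r) (by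
    rw [hn, div_le_iff₀ (by positivity)]; push_cast
    nlinarith [abs_nonneg θ])
  refine h1.trans ?_
  rw [hn, mul_pow]
  have h2 := Real.pow_div_factorial_le_exp (r + 1 : ℝ) (by positivity) (2 * r)
  have h3 : ν ^ (2 * r) / (2 * r).factorial ≤ Real.exp (r + 1) := by
    refine le_trans ?_ h2
    gcongr
  calc |θ| ^ (2 * r) * ν ^ (2 * r) / (2 * r).factorial * 2 = 2 * (ν ^ (2 * r) / (2 * r).factorial) * |θ| ^ (2 * r) := by ring
    _ ≤ _ := by gcongr

noncomputable def C2 (p : ℕ) : ℝ := 8 * Real.exp 2 * Cp p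

lemma pade_small (p r : ℕ) (hp : 1 ≤ p) (hr : 1 ≤ r) (a b : ℕ → ℤ)
    (ha : ∀ j, |(a j : ℝ)| ≤ Cp p ^ r) (hb : ∀ j, |(b j : ℝ)| ≤ Cp p ^ r)
    (h : ∀ q : Polynomial ℂ, q.natDegree < 2 * r →
        ∑ j ∈ Finset.range (r + 1), (a j : ℂ) * q.eval (j : ℂ) +
        ∑ i ∈ Finset.range (r + 1), (b i : ℂ) * q.eval ((i : ℂ) + 1 / p) = 0)
    (θ : ℝ) (hθ : |θ| ≤ 1 / 2) :
    ‖∑ j ∈ Finset.range (r + 1), (a j : ℂ) * Complex.exp (Complex.I * θ) ^ j +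
      Complex.exp (Complex.I * (θ / p : ℝ)) * ∑ i ∈ Finset.range (r + 1), (b i : ℂ) * Complex.exp (Complex.I * θ) ^ i‖
      ≤ C2 p ^ r * |θ| ^ (2 * r) := by
  have hpR : (1 : ℝ) ≤ p := by exact_mod_cast hp
  have hC : 0 ≤ Cp p := by unfold Cp; positivity
  set q : Polynomial ℂ := ∑ m ∈ Finset.range (2 * r), Polynomial.C ((Complex.I * θ) ^ m / m.factorial) * Polynomial.X ^ m with hq
  have hqd : q.natDegree < 2 * r := by
    have : q.natDegree ≤ 2 * r - 1 := by
      refine Polynomial.natDegree_sum_le_of_forall_le _ _ fun m hm => ?_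
      refine (Polynomial.natDegree_C_mul_X_pow_le _ _).trans ?_
      have := Finset.mem_range.mp hm; omega
    omega
  have hqe : ∀ ν : ℂ, q.eval ν = ∑ m ∈ Finset.range (2 * r), (Complex.I * θ * ν) ^ m / m.factorial := by
    intro ν
    rw [hq, Polynomial.eval_finset_sum]
    refine Finset.sum_congr rfl fun m _ => ?_
    simp; ring
  have h0 := h q hqd
  have e : ∑ j ∈ Finset.range (r + 1), (a j : ℂ) * Complex.exp (Complex.I * θ) ^ j +
      Complex.exp (Complex.I * (θ / p : ℝ)) * ∑ i ∈ Finset.range (r + 1), (b i : ℂ) * Complex.exp (Complex.I * θ) ^ i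
      = ∑ j ∈ Finset.range (r + 1), (a j : ℂ) * (Complex.exp (Complex.I * θ * (j : ℝ)) - q.eval ((j : ℝ) : ℂ)) +
        ∑ i ∈ Finset.range (r + 1), (b i : ℂ) * (Complex.exp (Complex.I * θ * ((i + 1 / p : ℝ) : ℂ)) - q.eval (((i + 1 / p : ℝ) : ℂ))) := by
    have e1 : ∀ j : ℕ, Complex.exp (Complex.I * θ) ^ j = Complex.exp (Complex.I * θ * (j : ℝ)) := by
      intro j; rw [← Complex.exp_nat_mul]; congr 1; push_cast; ring
    have e2 : ∀ j : ℕ, Complex.exp (Complex.I * (θ / p : ℝ)) * Complex.exp (Complex.I * θ) ^ j = Complex.exp (Complex.I * θ * ((j + 1 / p : ℝ) : ℂ)) := by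
      intro j; rw [← Complex.exp_nat_mul, ← Complex.exp_add]; congr 1; push_cast; ring
    rw [Finset.mul_sum]
    simp only [mul_sub, Finset.sum_sub_distrib, ← e1, ← e2]
    push_cast
    have : ∀ A B A' B' : ℂ, A' + B' = 0 → A + B = (A - A') + (B - B') := by
      intro A B A' B' h; linear_combination h
    rw [← this _ _ _ _ h0]
    congr 1
    refine Finset.sum_congr rfl fun _ _ => ?_
    ring
  rw [e]
  set M := 2 * Real.exp (r + 1) * |θ| ^ (2 * r) with hM
  have hr2 : (r + 1 : ℝ) ≤ 2 ^ r := by exact_mod_cast Nat.lt_two_pow_self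
  have hr1 : (1 : ℝ) ≤ r := by exact_mod_cast hr
  have s1 : ‖∑ j ∈ Finset.range (r + 1), (a j : ℂ) * (Complex.exp (Complex.I * θ * (j : ℝ)) - q.eval ((j : ℝ) : ℂ))‖ ≤ (r + 1) * (Cp p ^ r * M) := by
    refine (norm_sum_le _ _).trans ?_
    refine (Finset.sum_le_card_nsmul _ _ (Cp p ^ r * M) fun j hj => ?_).trans (by simp)
    rw [norm_mul, Complex.norm_intCast]
    have := Finset.mem_range.mp hj
    have hj' : (j : ℝ) ≤ r + 1 := by exact_mod_cast (by omega : j ≤ r + 1)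
    rw [hqe]
    exact mul_le_mul (ha j) (exp_rem r hr θ j hθ (by positivity) hj') (norm_nonneg _) (by positivity)
  have s2 : ‖∑ i ∈ Finset.range (r + 1), (b i : ℂ) * (Complex.exp (Complex.I * θ * ((i + 1 / p : ℝ) : ℂ)) - q.eval (((i + 1 / p : ℝ) : ℂ)))‖ ≤ (r + 1) * (Cp p ^ r * M) := by
    refine (norm_sum_le _ _).trans ?_
    refine (Finset.sum_le_card_nsmul _ _ (Cp p ^ r * M) fun j hj => ?_).trans (by simp)
    rw [norm_mul, Complex.norm_intCast]
    have := Finset.mem_range.mp hj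
    have hj' : (j : ℝ) ≤ r := by exact_mod_cast (by omega : j ≤ r)
    have hp1 : 1 / (p : ℝ) ≤ 1 := by rw [div_le_one (by linarith)]; exact hpR
    rw [hqe]
    exact mul_le_mul (hb j) (exp_rem r hr θ _ hθ (by positivity) (by linarith)) (norm_nonneg _) (by positivity)
  refine (norm_add_le _ _).trans ((add_le_add s1 s2).trans ?_)
  have s3 : Real.exp (r + 1) ≤ Real.exp 2 ^ r := by
    rw [← Real.exp_nat_mul]; apply Real.exp_le_exp.mpr; linarith
  have s4 : (4 : ℝ) ≤ 4 ^ r := by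
    calc (4 : ℝ) = 4 ^ 1 := by norm_num
      _ ≤ 4 ^ r := pow_le_pow_right₀ (by norm_num) hr
  calc (r + 1) * (Cp p ^ r * M) + (r + 1) * (Cp p ^ r * M) = 4 * (r + 1) * Real.exp (r + 1) * Cp p ^ r * |θ| ^ (2 * r) := by rw [hM]; ring
    _ ≤ 4 ^ r * 2 ^ r * Real.exp 2 ^ r * Cp p ^ r * |θ| ^ (2 * r) := by gcongr
    _ = _ := by rw [C2, mul_pow, mul_pow, ← mul_pow 4 2]; norm_num


open Polynomial in
lemma iter_der_X_pow (m n : ℕ) : (derivative^[m] (X ^ n : ℂ[X])).eval 1 = (descPochhammer ℂ m).eval (n : ℂ) := by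
  rw [descPochhammer_eval_eq_descFactorial, iterate_derivative_X_pow_eq_natCast_mul]
  simp

open Polynomial in
lemma phi_sum (m : ℕ) (s : Finset ℕ) (u v : ℕ → ℂ) :
    (derivative^[m] ((∑ j ∈ s, C (u j) * X ^ j) * (∑ i ∈ s, C (v i) * X ^ i) : ℂ[X])).eval 1 =
      ∑ i ∈ s, v i * ∑ j ∈ s, u j * (descPochhammer ℂ m).eval ((j : ℂ) + i) := by
  rw [Finset.sum_mul_sum, Finset.sum_comm]
  simp only [Polynomial.iterate_derivative_sum, Polynomial.eval_finsetSum, Finset.mul_sum]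
  refine Finset.sum_congr rfl fun i _ => Finset.sum_congr rfl fun j _ => ?_
  have : (C (u j) * X ^ j * (C (v i) * X ^ i) : ℂ[X]) = C (v i * u j) * X ^ (j + i) := by
    rw [C_mul, pow_add]; ring
  rw [this, iterate_derivative_C_mul, eval_C_mul, iter_der_X_pow]
  push_cast; ring

open Polynomial in
lemma det_ne (r : ℕ) (hr : 1 ≤ r) (ν : ℂ) (a b a' b' : ℕ → ℂ)
    (h : ∀ q : Polynomial ℂ, q.natDegree < 2 * r →
        ∑ j ∈ Finset.range (r + 1), a j * q.eval (j : ℂ) +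
        ∑ i ∈ Finset.range (r + 1), b i * q.eval ((i : ℂ) + ν) = 0)
    (h' : ∀ q : Polynomial ℂ, q.natDegree < 2 * r →
        ∑ j ∈ Finset.range (r + 1), a' j * q.eval (j : ℂ) +
        ∑ i ∈ Finset.range (r + 1), b' i * q.eval ((i : ℂ) + ν) = 0)
    (ha' : a' r ≠ 0) (hb : b r ≠ 0) (hb' : b' r = 0) (W : ℂ) (hW : W ≠ 1) :
    (∑ j ∈ Finset.range (r + 1), a j * W ^ j) * (∑ j ∈ Finset.range (r + 1), b' j * W ^ j) -
    (∑ j ∈ Finset.range (r + 1), a' j * W ^ j) * (∑ j ∈ Finset.range (r + 1), b j * W ^ j) ≠ 0 := by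
  set pl : (ℕ → ℂ) → ℂ[X] := fun u => ∑ j ∈ Finset.range (r + 1), C (u j) * X ^ j with hpl
  have hdeg : ∀ u, (pl u).natDegree ≤ r := by
    intro u
    refine natDegree_sum_le_of_forall_le _ _ fun m hm => ?_
    refine (natDegree_C_mul_X_pow_le _ _).trans ?_
    have := Finset.mem_range.mp hm; omega
  have hco : ∀ u, (pl u).coeff r = u r := by
    intro u
    simp only [hpl, finsetSum_coeff, coeff_C_mul, coeff_X_pow]
    simp
  have hev : ∀ u, (pl u).eval W = ∑ j ∈ Finset.range (r + 1), u j * W ^ j := by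
    intro u; simp [hpl, eval_finsetSum]
  set D := pl a * pl b' - pl a' * pl b with hD
  rw [← hev, ← hev, ← hev, ← hev, ← eval_mul, ← eval_mul, ← eval_sub, ← hD]
  have hDco : D.coeff (r + r) = - (a' r * b r) := by
    rw [hD, coeff_sub, coeff_mul_add_eq_of_natDegree_le (hdeg _) (hdeg _), coeff_mul_add_eq_of_natDegree_le (hdeg _) (hdeg _), hco, hco, hco, hco, hb']
    ring
  have hD0 : D ≠ 0 := by
    intro h0; rw [h0, coeff_zero] at hDco
    exact mul_ne_zero ha' hb (by linear_combination hDco)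
  have hDdeg : D.natDegree ≤ 2 * r := by
    refine (natDegree_sub_le _ _).trans (max_le ?_ ?_) <;> refine natDegree_mul_le.trans ?_ <;>
    · have := hdeg a; have := hdeg b; have := hdeg a'; have := hdeg b'; omega
  have hder : ∀ m < 2 * r, (derivative^[m] D).IsRoot 1 := by
    intro m hm
    rw [IsRoot, hD, iterate_derivative_sub, eval_sub, phi_sum, mul_comm (pl a'), phi_sum]
    have hq : ∀ i : ℕ, ((descPochhammer ℂ m).comp (X + C (i : ℂ))).natDegree < 2 * r := by
      intro i
      rw [natDegree_comp, descPochhammer_natDegree, natDegree_X_add_C]; omega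
    have e1 : ∀ i : ℕ, ∑ j ∈ Finset.range (r + 1), a j * (descPochhammer ℂ m).eval ((j : ℂ) + i) =
        - ∑ k ∈ Finset.range (r + 1), b k * (descPochhammer ℂ m).eval ((k : ℂ) + ν + i) := by
      intro i
      have := h _ (hq i)
      simp only [eval_comp, eval_add, eval_X, eval_C] at this
      linear_combination this
    have e2 : ∀ i : ℕ, ∑ j ∈ Finset.range (r + 1), a' j * (descPochhammer ℂ m).eval ((j : ℂ) + i) =
        - ∑ k ∈ Finset.range (r + 1), b' k * (descPochhammer ℂ m).eval ((k : ℂ) + ν + i) := by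
      intro i
      have := h' _ (hq i)
      simp only [eval_comp, eval_add, eval_X, eval_C] at this
      linear_combination this
    have e3 : ∑ i ∈ Finset.range (r + 1), b i * ∑ j ∈ Finset.range (r + 1), a' j * (descPochhammer ℂ m).eval ((i : ℂ) + j) =
      ∑ i ∈ Finset.range (r + 1), b i * ∑ j ∈ Finset.range (r + 1), a' j * (descPochhammer ℂ m).eval ((j : ℂ) + i) := by
      simp only [add_comm]
    have e4 : ∑ i ∈ Finset.range (r + 1), a' i * ∑ j ∈ Finset.range (r + 1), b j * (descPochhammer ℂ m).eval ((j : ℂ) + i) =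
      ∑ i ∈ Finset.range (r + 1), b i * ∑ j ∈ Finset.range (r + 1), a' j * (descPochhammer ℂ m).eval ((i : ℂ) + j) := by
      simp only [Finset.mul_sum]
      rw [Finset.sum_comm]
      refine Finset.sum_congr rfl fun i _ => Finset.sum_congr rfl fun j _ => ?_
      ring
    rw [e4, e3]
    simp only [e1, e2, mul_neg, Finset.sum_neg_distrib, Finset.mul_sum]
    rw [Finset.sum_comm, sub_neg_eq_add, neg_add_eq_zero]
    refine Finset.sum_congr rfl fun i _ => Finset.sum_congr rfl fun j _ => ?_
    rw [show (i : ℂ) + ν + j = j + ν + i by ring]; ring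
  have hmult : 2 * r ≤ D.rootMultiplicity 1 := by
    have := lt_rootMultiplicity_of_isRoot_iterate_derivative (n := 2 * r - 1) (t := (1 : ℂ)) hD0 (fun m hm => hder m (by omega))
    omega
  obtain ⟨Q, hQ⟩ := (le_rootMultiplicity_iff hD0).mp hmult
  have hQ0 : Q ≠ 0 := by rintro rfl; simp at hQ; exact hD0 hQ
  have hQd : Q.natDegree = 0 := by
    have := congrArg natDegree hQ
    rw [natDegree_mul (pow_ne_zero _ (X_sub_C_ne_zero _)) hQ0, natDegree_pow, natDegree_X_sub_C] at this
    omega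
  rw [hQ, eq_C_of_natDegree_eq_zero hQd, eval_mul, eval_pow, eval_sub, eval_X, eval_C, eval_C]
  refine mul_ne_zero (pow_ne_zero _ (sub_ne_zero.mpr hW)) ?_
  intro hc
  rw [eq_C_of_natDegree_eq_zero hQd, hc, C_0] at hQ0
  exact hQ0 rfl


lemma final_ineq (p r : ℕ) (hp : 5 ≤ p) (hr : 6 ≤ r) (u0 u1 : ℝ) (hu0 : 1 ≤ u0) (h1 : u0 ^ (2 * r) ≤ u1)
    (h2 : u1 ≤ u0 ^ (2 * r + 2)) :
    u0 ^ (p * r) * (u0 * u1) * (1 / u1 ^ (p - 1) + 1 / u0 ^ (2 * r * (p - 1))) ≤ 2 / u0 ^ (r - 3) := by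
  have hu0' : 0 < u0 := by linarith
  have hu1 : 1 ≤ u1 := (one_le_pow₀ hu0).trans h1
  have hu1' : 0 < u1 := by linarith
  obtain ⟨P, rfl⟩ : ∃ P, p = P + 5 := ⟨p - 5, by omega⟩
  obtain ⟨R, rfl⟩ : ∃ R, r = R + 3 := ⟨r - 3, by omega⟩
  simp only [show P + 5 - 1 = P + 4 by omega, Nat.add_sub_cancel]
  have i1 : u0 ^ ((P + 5) * (R + 3)) * (u0 * u1) * (1 / u1 ^ (P + 4)) ≤ 1 / u0 ^ R := by
    rw [mul_one_div, div_le_div_iff₀ (by positivity) (by positivity), one_mul]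
    calc u0 ^ ((P + 5) * (R + 3)) * (u0 * u1) * u0 ^ R = u0 ^ ((P + 5) * (R + 3) + 1 + R) * u1 := by rw [pow_add, pow_add]; ring
      _ ≤ u0 ^ (2 * (R + 3) * (P + 3)) * u1 := by
        gcongr
        nlinarith
      _ = (u0 ^ (2 * (R + 3))) ^ (P + 3) * u1 := by rw [← pow_mul]
      _ ≤ u1 ^ (P + 3) * u1 := by gcongr
      _ = _ := by ring
  have i2 : u0 ^ ((P + 5) * (R + 3)) * (u0 * u1) * (1 / u0 ^ (2 * (R + 3) * (P + 4))) ≤ 1 / u0 ^ R := by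
    rw [mul_one_div, div_le_div_iff₀ (by positivity) (by positivity), one_mul]
    calc u0 ^ ((P + 5) * (R + 3)) * (u0 * u1) * u0 ^ R ≤ u0 ^ ((P + 5) * (R + 3)) * (u0 * u0 ^ (2 * (R + 3) + 2)) * u0 ^ R := by gcongr
      _ = u0 ^ ((P + 5) * (R + 3) + 1 + (2 * (R + 3) + 2) + R) := by simp only [pow_add]; ring
      _ ≤ _ := by
        apply pow_le_pow_right₀ hu0
        nlinarith
  rw [mul_add]
  calc _ ≤ 1 / u0 ^ R + 1 / u0 ^ R := add_le_add i1 i2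
    _ = _ := by ring


noncomputable def Kp (p : ℕ) : ℝ := 128 * p ^ 2 * C2 p + 1

lemma C2_ge (p : ℕ) (hp : 1 ≤ p) : 8 * Cp p ≤ C2 p ∧ 1 ≤ Cp p := by
  have hpR : (1 : ℝ) ≤ p := by exact_mod_cast hp
  have h1 : 1 ≤ Real.exp 2 := Real.one_le_exp (by norm_num)
  have h2 : 1 ≤ Cp p := by
    rw [Cp]
    exact one_le_mul_of_one_le_of_one_le (one_le_pow₀ hpR) (Real.one_le_exp (by positivity))
  refine ⟨?_, h2⟩
  rw [C2]; nlinarith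

open ComplexConjugate in
lemma small_g {p y0 y1 : ℕ} {s0 t0 X0 E0 s1 t1 X1 E1 : ℤ} (hpp : p.Prime) (hp : 5 ≤ p)
    (S0 : Sol p y0 s0 t0 X0 E0) (S1 : Sol p y1 s1 t1 X1 E1) (hy0 : 0 < y0) (hy1 : 0 < y1)
    (ζ : ℂ) (hζ : ‖ζ‖ = 1) (Λ0 Λ1 : ℝ)
    (hα0 : al s0 t0 = ζ * Complex.exp (Complex.I * (Λ0 / p : ℝ)))
    (hα0p : al s0 t0 ^ p = Complex.exp (Complex.I * (Λ0 : ℝ)))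
    (hΛ0 : |Λ0| ≤ 2 * ‖al s0 t0 ^ p - 1‖)
    (hα1 : al s1 t1 = ζ * Complex.exp (Complex.I * (Λ1 / p : ℝ)))
    (hΛ1 : |Λ1| ≤ 2 * ‖al s1 t1 ^ p - 1‖)
    (r : ℕ) (hr : 6 ≤ r) (hu0 : Kp p ^ 2 ≤ √(y0 : ℝ)) (hg1 : (y0 ^ 2) ^ r ≤ y1) (hg2 : y1 ≤ (y0 ^ 2) ^ (r + 1))
    (a b : ℕ → ℤ) (ha : ∀ j, |(a j : ℝ)| ≤ Cp p ^ r) (hb : ∀ j, |(b j : ℝ)| ≤ Cp p ^ r)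
    (h : ∀ q : Polynomial ℂ, q.natDegree < 2 * r →
        ∑ j ∈ Finset.range (r + 1), (a j : ℂ) * q.eval (j : ℂ) +
        ∑ i ∈ Finset.range (r + 1), (b i : ℂ) * q.eval ((i : ℂ) + 1 / p) = 0) :
    (∑ j ∈ Finset.range (r + 1), (a j : ℂ) * al X0 E0 ^ j) * al s1 t1 +
      al s0 t0 * (∑ i ∈ Finset.range (r + 1), (b i : ℂ) * al X0 E0 ^ i) = 0 := by
  have hpR : (5 : ℝ) ≤ p := by exact_mod_cast hp
  have hodd : Odd p := hpp.odd_of_ne_two (by omega)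
  have hρ : 2 * ((p - 1) / 2) = p - 1 := by obtain ⟨k, hk⟩ := hodd; omega
  obtain ⟨hC28, hCp1⟩ := C2_ge p (by omega)
  have hC2 : 1 ≤ C2 p := by linarith
  have hK1 : 8 * p ≤ Kp p := by rw [Kp]; nlinarith
  set u0 := √(y0 : ℝ) with hu0d
  set u1 := √(y1 : ℝ) with hu1d
  have hu0sq : u0 ^ 2 = y0 := Real.sq_sqrt (by positivity)
  have hu1sq : u1 ^ 2 = y1 := Real.sq_sqrt (by positivity)
  have hu0n : 0 ≤ u0 := Real.sqrt_nonneg _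
  have hu1n : 0 ≤ u1 := Real.sqrt_nonneg _
  have hu08 : 8 * p ≤ u0 := by nlinarith
  have hu0one : 1 ≤ u0 := by linarith
  have h1 : u0 ^ (2 * r) ≤ u1 := by
    have : ((y0 : ℝ) ^ 2) ^ r ≤ y1 := by exact_mod_cast hg1
    apply le_of_sq_le_sq _ hu1n
    rw [hu1sq, ← pow_mul, mul_comm, pow_mul, hu0sq, pow_mul]; exact this
  have h2 : u1 ≤ u0 ^ (2 * r + 2) := by
    have : (y1 : ℝ) ≤ ((y0 : ℝ) ^ 2) ^ (r + 1) := by exact_mod_cast hg2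
    apply le_of_sq_le_sq _ (by positivity)
    rw [hu1sq, ← pow_mul, mul_comm, pow_mul, hu0sq, show 2 * r + 2 = 2 * (r + 1) by ring, pow_mul]; exact this
  have hu1one : 1 ≤ u1 := (one_le_pow₀ hu0one).trans h1
  -- closeness of the arguments
  have c0 : |Λ0| ≤ 4 * p / u0 ^ (p - 1) := by
    have := sol_close S0 hodd hy0
    rw [← hu0sq, ← pow_mul, hρ] at this
    rw [le_div_iff₀ (by positivity)]
    have hpos : 0 ≤ u0 ^ (p - 1) := by positivity
    nlinarith
  have c1 : |Λ1| ≤ 4 * p / u1 ^ (p - 1) := by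
    have := sol_close S1 hodd hy1
    rw [← hu1sq, ← pow_mul, hρ] at this
    rw [le_div_iff₀ (by positivity)]
    have hpos : 0 ≤ u1 ^ (p - 1) := by positivity
    nlinarith
  have c0h : |Λ0| ≤ 1 / 2 := by
    refine c0.trans ?_
    have : u0 ≤ u0 ^ (p - 1) := le_self_pow₀ hu0one (by omega)
    rw [div_le_div_iff₀ (by positivity) (by norm_num)]
    linarith
  set W := al X0 E0 with hW
  have hWe : W = Complex.exp (Complex.I * (Λ0 : ℝ)) := by rw [hW, ← sol_al_pow S0, hα0p]
  have hWn : ‖W‖ = 1 := al_norm X0 E0 S0.2.2.1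
  set A := ∑ j ∈ Finset.range (r + 1), (a j : ℂ) * W ^ j with hA
  set B := ∑ j ∈ Finset.range (r + 1), (b j : ℂ) * W ^ j with hB
  have hF := pade_small p r (by omega) (by omega) a b ha hb h Λ0 c0h
  rw [← hWe, ← hA, ← hB] at hF
  have hAn : ‖A‖ ≤ (r + 1) * Cp p ^ r := by
    refine (norm_sum_le _ _).trans ?_
    refine (Finset.sum_le_card_nsmul _ _ (Cp p ^ r) fun j hj => ?_).trans (by simp)
    rw [norm_mul, Complex.norm_intCast, norm_pow, hWn, one_pow, mul_one]
    exact ha j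
  have hη : ‖Complex.exp (Complex.I * (Λ1 / p : ℝ)) - 1‖ ≤ 4 / u1 ^ (p - 1) := by
    have e := Real.norm_exp_I_mul_ofReal_sub_one_le (x := Λ1 / p)
    refine e.trans ?_
    rw [Real.norm_eq_abs, abs_div, Nat.abs_cast, div_le_iff₀ (by positivity)]
    refine c1.trans (le_of_eq ?_)
    ring
  set P := C2 p ^ r * (16 * p ^ 2) ^ r with hP
  have hr2 : (r + 1 : ℝ) ≤ 2 ^ r := by exact_mod_cast Nat.lt_two_pow_self
  have s4 : (4 : ℝ) ≤ 4 ^ r := by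
    calc (4 : ℝ) = 4 ^ 1 := by norm_num
      _ ≤ 4 ^ r := pow_le_pow_right₀ (by norm_num) (by omega)
  have hPA : (r + 1) * Cp p ^ r * 4 ≤ P := by
    calc (r + 1) * Cp p ^ r * 4 ≤ 2 ^ r * Cp p ^ r * 4 ^ r := by gcongr
      _ = (8 * Cp p) ^ r := by rw [mul_right_comm, ← mul_pow, ← mul_pow]; norm_num
      _ ≤ C2 p ^ r := by gcongr
      _ ≤ P := by
        rw [hP]; exact le_mul_of_one_le_right (by positivity) (one_le_pow₀ (by nlinarith))
  have hFn : C2 p ^ r * |Λ0| ^ (2 * r) ≤ P * (1 / u0 ^ (2 * r * (p - 1))) := by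
    calc C2 p ^ r * |Λ0| ^ (2 * r) ≤ C2 p ^ r * (4 * p / u0 ^ (p - 1)) ^ (2 * r) := by gcongr
      _ = _ := by
        rw [div_pow, ← pow_mul, pow_mul (4 * (p : ℝ)), hP, mul_comm (p - 1)]
        rw [show (4 * (p : ℝ)) ^ 2 = 16 * p ^ 2 by ring]; ring
  have hN : ‖A * al s1 t1 + al s0 t0 * B‖ ≤ P * (1 / u1 ^ (p - 1) + 1 / u0 ^ (2 * r * (p - 1))) := by
    have e : A * al s1 t1 + al s0 t0 * B = ζ * (A * (Complex.exp (Complex.I * (Λ1 / p : ℝ)) - 1) +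
        (A + Complex.exp (Complex.I * (Λ0 / p : ℝ)) * B)) := by rw [hα0, hα1]; ring
    rw [e, norm_mul, hζ, one_mul]
    refine (norm_add_le _ _).trans ?_
    rw [mul_add]
    refine add_le_add ?_ (hF.trans hFn)
    rw [norm_mul]
    calc ‖A‖ * ‖Complex.exp (Complex.I * (Λ1 / p : ℝ)) - 1‖ ≤ ((r + 1) * Cp p ^ r) * (4 / u1 ^ (p - 1)) := by gcongr
      _ = ((r + 1) * Cp p ^ r * 4) * (1 / u1 ^ (p - 1)) := by ring
      _ ≤ _ := by gcongr
  -- the Gaussian integer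
  obtain ⟨gA, hgA⟩ := clear_denom X0 E0 S0.2.2.1 r (fun i : Fin (r + 1) => a i) (fun i => i) (fun i => by omega)
  obtain ⟨gB, hgB⟩ := clear_denom X0 E0 S0.2.2.1 r (fun i : Fin (r + 1) => b i) (fun i => i) (fun i => by omega)
  rw [Fin.sum_univ_eq_sum_range (fun i => (a i : ℂ) * al X0 E0 ^ i), ← hW, ← hA] at hgA
  rw [Fin.sum_univ_eq_sum_range (fun i => (b i : ℂ) * al X0 E0 ^ i), ← hW, ← hB] at hgB
  have hz0 := zc_ne s0 t0 S0.2.1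
  have hz1 := zc_ne s1 t1 S1.2.1
  have hw := zc_ne X0 E0 S0.2.2.1
  have hz0c : conj (zc s0 t0) ≠ 0 := (map_ne_zero _).mpr hz0
  have hz1c : conj (zc s1 t1) ≠ 0 := (map_ne_zero _).mpr hz1
  have hwc : conj (zc X0 E0) ≠ 0 := (map_ne_zero _).mpr hw
  set g : GaussianInt := gA * ⟨s1, t1⟩ * star ⟨s0, t0⟩ + gB * ⟨s0, t0⟩ * star ⟨s1, t1⟩ with hg
  have hgc : GaussianInt.toComplex g = conj (zc X0 E0) ^ r * (conj (zc s0 t0) * conj (zc s1 t1)) * (A * al s1 t1 + al s0 t0 * B) := by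
    rw [hg, map_add, map_mul, map_mul, map_mul, map_mul, hgA, hgB, GaussianInt.toComplex_star, GaussianInt.toComplex_star, ← zc_eq, ← zc_eq, al, al]
    field_simp
  have n0 : ‖zc s0 t0‖ = √2 * u0 := by
    rw [← Real.sqrt_sq (norm_nonneg (zc s0 t0)), sol_norm S0, Real.sqrt_mul (by norm_num)]
  have n1 : ‖zc s1 t1‖ = √2 * u1 := by
    rw [← Real.sqrt_sq (norm_nonneg (zc s1 t1)), sol_norm S1, Real.sqrt_mul (by norm_num)]
  have nw : ‖zc X0 E0‖ = √2 * u0 ^ p := by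
    rw [← Real.sqrt_sq (norm_nonneg (zc X0 E0)), sol_norm' S0, Real.sqrt_mul (by norm_num)]
    congr 1
    rw [← hu0sq, ← pow_mul, mul_comm, pow_mul, Real.sqrt_sq (by positivity)]
  have hs2 : √(2 : ℝ) * √2 = 2 := Real.mul_self_sqrt (by norm_num)
  have hs2' : √(2 : ℝ) ≤ 2 := by rw [Real.sqrt_le_left (by norm_num)]; norm_num
  have hP0 : 0 ≤ P := by positivity
  have hgn : ‖GaussianInt.toComplex g‖ < 1 := by
    rw [hgc, norm_mul, norm_mul, norm_mul, norm_pow, Complex.norm_conj, Complex.norm_conj, Complex.norm_conj, n0, n1, nw]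
    have hfi := final_ineq p r hp hr u0 u1 hu0one h1 h2
    calc (√2 * u0 ^ p) ^ r * (√2 * u0 * (√2 * u1)) * ‖A * al s1 t1 + al s0 t0 * B‖
        ≤ (√2 * u0 ^ p) ^ r * (√2 * u0 * (√2 * u1)) * (P * (1 / u1 ^ (p - 1) + 1 / u0 ^ (2 * r * (p - 1)))) := by gcongr
      _ = √2 ^ r * (√2 * √2) * P * (u0 ^ (p * r) * (u0 * u1) * (1 / u1 ^ (p - 1) + 1 / u0 ^ (2 * r * (p - 1)))) := by
          rw [mul_pow, ← pow_mul]; ring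
      _ ≤ 2 ^ r * 2 * P * (2 / u0 ^ (r - 3)) := by rw [hs2]; gcongr
      _ = (4 * (2 ^ r * P)) / u0 ^ (r - 3) := by ring
      _ < 1 := by
        rw [div_lt_one (by positivity)]
        calc 4 * (2 ^ r * P) ≤ 4 ^ r * (2 ^ r * P) := by gcongr
          _ = (128 * p ^ 2 * C2 p) ^ r := by rw [hP, ← mul_pow, ← mul_pow, ← mul_pow]; congr 1; ring
          _ < Kp p ^ r := by
            apply pow_lt_pow_left₀ (by rw [Kp]; linarith) (by positivity) (by omega)
          _ ≤ (Kp p ^ 2) ^ (r - 3) := by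
            rw [← pow_mul]; apply pow_le_pow_right₀ (by linarith) (by omega)
          _ ≤ u0 ^ (r - 3) := by gcongr
  have hg0 := gauss_small g hgn
  rw [hg0, map_zero] at hgc
  have := mul_ne_zero (pow_ne_zero r hwc) (mul_ne_zero hz0c hz1c)
  exact (mul_eq_zero.mp hgc.symm).resolve_left this


lemma al_ne_one (X E : ℤ) (hE : E ≠ 0) : al X E ≠ 1 := by
  intro h
  have h1 := al_sub_one X E hE
  rw [h, sub_self, norm_zero, zero_mul] at h1
  have : (E : ℝ) ≠ 0 := by exact_mod_cast hE
  have := abs_pos.mpr this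
  linarith

lemma gap {p y0 y1 : ℕ} {s0 t0 X0 E0 s1 t1 X1 E1 : ℤ} (hpp : p.Prime) (hp : 5 ≤ p)
    (S0 : Sol p y0 s0 t0 X0 E0) (S1 : Sol p y1 s1 t1 X1 E1) (hy0 : 2 ≤ y0)
    (ζ : ℂ) (hζ : ‖ζ‖ = 1) (Λ0 Λ1 : ℝ)
    (hα0 : al s0 t0 = ζ * Complex.exp (Complex.I * (Λ0 / p : ℝ)))
    (hα0p : al s0 t0 ^ p = Complex.exp (Complex.I * (Λ0 : ℝ)))
    (hΛ0 : |Λ0| ≤ 2 * ‖al s0 t0 ^ p - 1‖)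
    (hα1 : al s1 t1 = ζ * Complex.exp (Complex.I * (Λ1 / p : ℝ)))
    (hΛ1 : |Λ1| ≤ 2 * ‖al s1 t1 ^ p - 1‖)
    (hu0 : Kp p ^ 2 ≤ √(y0 : ℝ)) (hy1 : (y0 ^ 2) ^ 6 ≤ y1) : False := by
  have hb2 : 1 < y0 ^ 2 := by nlinarith
  have hy1p : 0 < y1 := lt_of_lt_of_le (by positivity) hy1
  obtain ⟨r, hr⟩ : ∃ r, r = Nat.log (y0 ^ 2) y1 := ⟨_, rfl⟩
  have hr6 : 6 ≤ r := by rw [hr]; exact Nat.le_log_of_pow_le hb2 hy1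
  have hg1 : (y0 ^ 2) ^ r ≤ y1 := by rw [hr]; exact Nat.pow_log_le_self _ hy1p.ne'
  have hg2 : y1 ≤ (y0 ^ 2) ^ (r + 1) := by rw [hr]; exact (Nat.lt_pow_succ_log_self hb2 _).le
  obtain ⟨a, b, ha, hb, har, hbr, -, hann⟩ := pade1 p hpp r r le_rfl (by omega)
  obtain ⟨a', b', ha', hb', har', -, hb0', hann'⟩ := pade1 p hpp r (r - 1) (by omega) (by omega)
  have hann1 : ∀ q : Polynomial ℂ, q.natDegree < 2 * r →
        ∑ j ∈ Finset.range (r + 1), (a j : ℂ) * q.eval (j : ℂ) +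
        ∑ i ∈ Finset.range (r + 1), (b i : ℂ) * q.eval ((i : ℂ) + 1 / p) = 0 := fun q hq => hann q (by omega)
  have hann2 : ∀ q : Polynomial ℂ, q.natDegree < 2 * r →
        ∑ j ∈ Finset.range (r + 1), (a' j : ℂ) * q.eval (j : ℂ) +
        ∑ i ∈ Finset.range (r + 1), (b' i : ℂ) * q.eval ((i : ℂ) + 1 / p) = 0 := fun q hq => hann' q (by omega)
  have e1 := small_g hpp hp S0 S1 (by omega) hy1p ζ hζ Λ0 Λ1 hα0 hα0p hΛ0 hα1 hΛ1 r hr6 hu0 hg1 hg2 a b ha hb hann1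
  have e2 := small_g hpp hp S0 S1 (by omega) hy1p ζ hζ Λ0 Λ1 hα0 hα0p hΛ0 hα1 hΛ1 r hr6 hu0 hg1 hg2 a' b' ha' hb' hann2
  have hD := det_ne r (by omega) (1 / p : ℂ) (fun j => (a j : ℂ)) (fun j => (b j : ℂ)) (fun j => (a' j : ℂ)) (fun j => (b' j : ℂ))
    hann1 hann2 (by simpa using har') (by simpa using hbr) (by simp [hb0' r (by omega)]) (al X0 E0) (al_ne_one X0 E0 S0.2.2.1)
  apply hD
  have hα : al s0 t0 ≠ 0 := by
    intro h; have := al_norm s0 t0 S0.2.1; rw [h] at this; simp at this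
  refine (mul_eq_zero.mp ?_).resolve_left hα
  generalize al s0 t0 = α0 at *
  generalize al s1 t1 = α1 at *
  linear_combination (∑ j ∈ Finset.range (r + 1), (a j : ℂ) * al X0 E0 ^ j) * e2 -
    (∑ j ∈ Finset.range (r + 1), (a' j : ℂ) * al X0 E0 ^ j) * e1

lemma partB (p : ℕ) (hpp : p.Prime) (hp : 5 ≤ p) : ∃ Y : ℕ, ∀ y : ℕ, ∀ s t X E : ℤ, Sol p y s t X E → y ≤ Y := by
  by_contra! hcon
  choose y s t X E hS hy using hcon
  have hr := fun n => root_near (al (s n) (t n)) (al_norm _ _ (hS n).2.1) p hpp.pos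
  choose k hk Λ h1 h2 h3 using hr
  obtain ⟨k0, hk0⟩ := Finite.exists_infinite_fiber (fun n => (⟨k n, hk n⟩ : Fin p))
  have hinf : ((fun n => (⟨k n, hk n⟩ : Fin p)) ⁻¹' {k0}).Infinite := Set.infinite_coe_iff.mp hk0
  obtain ⟨N, hN⟩ := exists_nat_ge ((Kp p ^ 2) ^ 2)
  obtain ⟨n0, hn0, hn0'⟩ := hinf.exists_gt (N + 2)
  obtain ⟨n1, hn1, hn1'⟩ := hinf.exists_gt ((y n0 ^ 2) ^ 6)
  have hk0' : k n0 = k n1 := by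
    have a1 : (⟨k n0, hk n0⟩ : Fin p) = k0 := hn0
    have a2 : (⟨k n1, hk n1⟩ : Fin p) = k0 := hn1
    have := a1.trans a2.symm
    simpa using this
  have hy0 := hy n0
  have hy1 := hy n1
  have h1' := h1 n1
  rw [← hk0'] at h1'
  refine gap hpp hp (hS n0) (hS n1) (by omega) (Complex.exp (Complex.I * (2 * Real.pi * k n0 / p : ℝ))) ?_ (Λ n0) (Λ n1)
    (h1 n0) (h2 n0) (h3 n0) h1' (h3 n1) ?_ (by omega)
  · rw [mul_comm]; exact Complex.norm_exp_ofReal_mul_I _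
  · apply Real.le_sqrt_of_sq_le
    refine hN.trans ?_
    exact_mod_cast (by omega : N ≤ y n0)


/-- There are only finitely many tuples `(x, y, m, q, p)` with `x, y, m` positive,
`p, q` odd primes, `p > 3`, `gcd(x,y) = 1`, `x² + q^(2m) = 2y^p`, and `y` not a sum
of two consecutive squares. -/
theorem finitely_many_solutions :
    {t : ℕ × ℕ × ℕ × ℕ × ℕ |
      0 < t.1 ∧ 0 < t.2.1 ∧ 0 < t.2.2.1 ∧
      Nat.Prime t.2.2.2.1 ∧ Odd t.2.2.2.1 ∧
      Nat.Prime t.2.2.2.2 ∧ Odd t.2.2.2.2 ∧ 3 < t.2.2.2.2 ∧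
      Nat.gcd t.1 t.2.1 = 1 ∧
      t.1 ^ 2 + t.2.2.2.1 ^ (2 * t.2.2.1) = 2 * t.2.1 ^ t.2.2.2.2 ∧
      ∀ s : ℤ, (t.2.1 : ℤ) ≠ s ^ 2 + (s + 1) ^ 2}.Finite := by
  obtain ⟨P0, hP0⟩ := partA
  have hB : ∀ p : ℕ, ∃ Y : ℕ, p.Prime → 5 ≤ p → ∀ y : ℕ, ∀ s t X E : ℤ, Sol p y s t X E → y ≤ Y := by
    intro p
    by_cases h : p.Prime ∧ 5 ≤ p
    · obtain ⟨Y, hY⟩ := partB p h.1 h.2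
      exact ⟨Y, fun _ _ => hY⟩
    · exact ⟨0, fun h1 h2 => absurd ⟨h1, h2⟩ h⟩
  choose Y hY using hB
  set YM := ∑ p ∈ Finset.range P0, Y p with hYM
  set M := 2 * (YM + 1) ^ P0 with hM
  refine Set.Finite.subset (Set.finite_Iic ((M, YM, M, M, P0) : ℕ × ℕ × ℕ × ℕ × ℕ)) ?_
  rintro ⟨x, y, m, q, p⟩ ⟨hx, hy, hm, hq, hqo, hp, hpo, hp3, hc, h, hs⟩
  dsimp only at *
  have hp5 : 5 ≤ p := by
    obtain ⟨k, hk⟩ := hpo; omega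
  have hy2 : 2 ≤ y := by
    rcases Nat.lt_or_ge y 2 with h1 | h1
    · have : y = 1 := by omega
      subst this
      exact absurd (by norm_num) (hs 0)
    · exact h1
  obtain ⟨s, t, X, E, hS⟩ := exists_sol x y m q p hx hy hm hq hqo hp hpo hc h hs
  have hpP : p < P0 := by
    by_contra hcon
    exact hP0 p y s t X E hp (by omega) hy2 hS
  have hyY : y ≤ YM := (hY p hp hp5 y s t X E hS).trans
    (Finset.single_le_sum (f := Y) (fun _ _ => Nat.zero_le _) (Finset.mem_range.mpr hpP))
  have hMM : 2 * y ^ p ≤ M := by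
    rw [hM]
    have : y ^ p ≤ (YM + 1) ^ P0 := (Nat.pow_le_pow_left (by omega : y ≤ YM + 1) p).trans
      (Nat.pow_le_pow_right (by omega) hpP.le)
    omega
  have hqM : q ^ (2 * m) ≤ M := by omega
  have hxM : x ≤ M := (Nat.le_self_pow (by norm_num : 2 ≠ 0) x).trans (by omega)
  have hq' : q ≤ M := (Nat.le_self_pow (by omega : 2 * m ≠ 0) q).trans hqM
  have hm' : m ≤ M := by
    have h1 : 2 * m < 2 ^ (2 * m) := Nat.lt_two_pow_self
    have h2 : 2 ^ (2 * m) ≤ q ^ (2 * m) := Nat.pow_le_pow_left hq.two_le _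
    omega
  exact ⟨hxM, hyY, hm', hq', hpP.le⟩
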